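/- arXiv:2108.12733 — 7 statements merged into one kernel-verified Lean document; each statement's English description precedes it below -/
import Mathlib

section
/- Let p be an odd prime, let a be an integer with 1 ≤ a ≤ p−1, and let i be a positive even integer with gcd(i,p) = 1, i ≢ 0 (mod p−1) and i ≢ 2 (mod p−1). Then (a^i − 1)·B_i/i ≡ Σ_{b=1}^{p−1} ⌊ab/p⌋·r(ab)^{i−1} + p·((i−1)/2)·a^{i−2}·Σ_{b=1}^{p−1} ⌊ab/p⌋²·b^{i−2} (mod p²), where r(x) ∈ {0,…,p−1} denotes the least nonnegative residue of x modulo p. -/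
/-- `x ≡ y (mod p^r)` for rationals: `x - y = p^r * t` with the denominator of `t`
prime to `p`, i.e. the `p`-adic valuation of `x - y` is at least `r`. -/
def ratCongr (p r : ℕ) (x y : ℚ) : Prop :=
  ∃ t : ℚ, x - y = (p : ℚ) ^ r * t ∧ ¬ (p ∣ t.den)

namespace VorSharp

/-- The subring of `p`-integral rationals. -/
def pInt (p : ℕ) (hp : p.Prime) : Subring ℚ where
  carrier := {x | ¬ p ∣ x.den}
  mul_mem' := by
    intro x y hx hy h
    have := h.trans (Rat.mul_den_dvd x y)
    rcases (Nat.Prime.dvd_mul hp).1 this with h | h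
    · exact hx h
    · exact hy h
  one_mem' := by
    intro h
    exact hp.one_lt.ne' (Nat.dvd_one.1 (by simpa using h))
  add_mem' := by
    intro x y hx hy h
    have := h.trans (Rat.add_den_dvd x y)
    rcases (Nat.Prime.dvd_mul hp).1 this with h | h
    · exact hx h
    · exact hy h
  zero_mem' := by
    intro h
    exact hp.one_lt.ne' (Nat.dvd_one.1 (by simpa using h))
  neg_mem' := by
    intro x hx
    simpa using hx

lemma inv_mem {p : ℕ} (hp : p.Prime) {d : ℕ} (hd : ¬ p ∣ d) : ((d : ℚ))⁻¹ ∈ pInt p hp := by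
  change ¬ p ∣ ((d : ℚ)⁻¹).den
  intro h
  apply hd
  refine h.trans ?_
  rw [Rat.inv_natCast_den]
  split_ifs <;> simp

lemma bern_mem {p : ℕ} (hp : p.Prime) {n : ℕ} (hn : Even n) (h : ¬ (p - 1) ∣ n) :
    bernoulli n ∈ pInt p hp := by
  obtain ⟨k, hk⟩ := hn
  obtain rfl : n = 2 * k := by omega
  obtain ⟨z, hz⟩ := Bernoulli.vonStaudt_clausen k
  rw [eq_sub_iff_add_eq.2 hz.symm]
  refine sub_mem (intCast_mem _ z) (sum_mem fun q hq => ?_)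
  simp only [Finset.mem_filter] at hq
  rw [one_div]
  apply inv_mem
  intro hd
  rw [Nat.prime_dvd_prime_iff_eq hp hq.2.1] at hd
  subst hd
  exact h hq.2.2

lemma p_bern_mem {p : ℕ} (hp : p.Prime) (h3 : p ≠ 2) (n : ℕ) :
    (p : ℚ) * bernoulli n ∈ pInt p hp := by
  rcases Nat.even_or_odd n with hn | hn
  · obtain ⟨k, hk⟩ := hn
    obtain rfl : n = 2 * k := by omega
    obtain ⟨z, hz⟩ := Bernoulli.vonStaudt_clausen k
    rw [eq_sub_iff_add_eq.2 hz.symm, mul_sub, Finset.mul_sum]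
    refine sub_mem (mul_mem (natCast_mem _ _) (intCast_mem _ z)) (sum_mem fun q hq => ?_)
    simp only [Finset.mem_filter] at hq
    by_cases hd : p = q
    · subst hd
      have : (p : ℚ) ≠ 0 := by exact_mod_cast hp.ne_zero
      rw [mul_one_div_cancel this]
      exact one_mem _
    · rw [one_div]
      refine mul_mem (natCast_mem _ _) (inv_mem hp fun h => ?_)
      exact hd ((Nat.prime_dvd_prime_iff_eq hp hq.2.1).1 h)
  · rcases Nat.lt_or_ge 1 n with h1 | h1
    · rw [bernoulli_eq_zero_of_odd hn h1, mul_zero]; exact zero_mem _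
    · obtain rfl : n = 1 := by obtain ⟨k, hk⟩ := hn; omega
      rw [bernoulli_one]
      have := inv_mem hp (d := 2) (fun h => h3 ((Nat.prime_dvd_prime_iff_eq hp Nat.prime_two).1 h))
      have h2 : (p : ℚ) * (-1 / 2) = (p : ℚ) * (-((2 : ℕ) : ℚ)⁻¹) := by push_cast; ring
      rw [h2]
      exact mul_mem (natCast_mem _ _) (neg_mem this)

lemma pow_div {p : ℕ} (hp : p.Prime) (h7 : 7 ≤ p) (k : ℕ) (hk : 3 ≤ k) :
    ∃ t ∈ pInt p hp, (p : ℚ) ^ (k - 1) / (k + 1) = (p : ℚ) ^ 2 * t := by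
  obtain ⟨e, m, hm, he⟩ := Nat.exists_eq_pow_mul_and_not_dvd (n := k + 1) (by omega) p hp.ne_one
  have hlt : e ≤ k - 3 := by
    by_contra hcon
    have h1 : k - 2 ≤ e := by omega
    have h2 : p ^ (k - 2) ∣ k + 1 := by rw [he]; exact (pow_dvd_pow p h1).mul_right m
    have h3 := Nat.le_of_dvd (by omega) h2
    have h4 : 7 ^ (k - 2) ≤ p ^ (k - 2) := Nat.pow_le_pow_left h7 _
    have h5 : ∀ j : ℕ, j + 4 < 7 ^ (j + 1) := by
      intro j
      induction j with
      | zero => norm_num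
      | succ j ih => rw [pow_succ]; omega
    have h6 := h5 (k - 3)
    rw [show k - 3 + 1 = k - 2 by omega] at h6
    omega
  refine ⟨(p : ℚ) ^ (k - 3 - e) * (m : ℚ)⁻¹,
    mul_mem (pow_mem (natCast_mem _ _) _) (inv_mem hp hm), ?_⟩
  have hp0 : (p : ℚ) ≠ 0 := by exact_mod_cast hp.ne_zero
  have hm0 : (m : ℚ) ≠ 0 := by
    rintro h
    apply hm
    have : m = 0 := by exact_mod_cast h
    simp [this]
  have he' : (k : ℚ) + 1 = (p : ℚ) ^ e * m := by exact_mod_cast he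
  rw [he', show k - 1 = 2 + (k - 3 - e) + e by omega, pow_add, pow_add]
  field_simp

lemma sum_pow {p : ℕ} (hp : p.Prime) (h7 : 7 ≤ p) (i : ℕ) (hi : 4 ≤ i) (he : Even i)
    (h2 : ¬ (p - 1) ∣ (i - 2)) :
    ∃ t ∈ pInt p hp, ∑ b ∈ Finset.range p, (b : ℚ) ^ i = p * bernoulli i + (p : ℚ) ^ 3 * t := by
  have key : ∀ j ∈ Finset.range i, ∃ t ∈ pInt p hp,
      bernoulli j * ((i + 1).choose j) * (p : ℚ) ^ (i + 1 - j) / (i + 1) = (p : ℚ) ^ 3 * t := by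
    intro j hj
    rw [Finset.mem_range] at hj
    obtain ⟨k, rfl⟩ := Nat.exists_eq_add_of_lt hj
    set n := k + 1 with hn
    have hch : ((j + k + 1 + 1).choose j : ℚ) / ((j + k + 1 : ℕ) + 1)
        = ((j + k + 1).choose j : ℚ) / (n + 1) := by
      have h := Nat.add_one_mul_choose_eq (j + k + 1) (k + 1)
      have e1 : (j + k + 1).choose (k + 1) = (j + k + 1).choose j :=
        Nat.choose_symm_of_eq_add (by omega)
      have e2 : (j + k + 1 + 1).choose (k + 1 + 1) = (j + k + 1 + 1).choose j :=
        Nat.choose_symm_of_eq_add (by omega)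
      rw [e1, e2] at h
      rw [div_eq_div_iff (by positivity) (by positivity)]
      have h' : ((j + k + 1 : ℕ) + 1 : ℚ) * ((j + k + 1).choose j : ℚ)
        = ((j + k + 1 + 1).choose j : ℚ) * (n + 1) := by rw [hn]; exact_mod_cast h
      linarith
    have hterm : bernoulli j * ((j + k + 1 + 1).choose j) * (p : ℚ) ^ (j + k + 1 + 1 - j) /
        ((j + k + 1 : ℕ) + 1) =
        bernoulli j * ((j + k + 1).choose j : ℚ) * ((p : ℚ) ^ (n + 1) / (n + 1)) := by
      rw [show j + k + 1 + 1 - j = n + 1 by omega, mul_div_right_comm, mul_div_assoc, hch]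
      ring
    rw [hterm]
    rcases Nat.lt_or_ge n 3 with h3 | h3
    · obtain h | h : n = 1 ∨ n = 2 := by omega
      · refine ⟨0, zero_mem _, ?_⟩
        rw [bernoulli_eq_zero_of_odd (n := j) (by
          obtain ⟨c, hc⟩ := he; exact ⟨c - 1, by omega⟩) (by omega)]
        ring
      · have hB := bern_mem hp (n := j) (by
          obtain ⟨c, hc⟩ := he; exact ⟨c - 1, by omega⟩)
          (by rwa [show j + k + 1 - 2 = j by omega] at h2)
        have h3i := inv_mem hp (d := 3) (fun h => by
          have := Nat.le_of_dvd (by norm_num) h; omega)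
        refine ⟨bernoulli j * ((j + k + 1).choose j : ℚ) * ((3 : ℕ) : ℚ)⁻¹,
          mul_mem (mul_mem hB (natCast_mem _ _)) h3i, ?_⟩
        rw [h]; push_cast; ring
    · obtain ⟨t, ht, hte⟩ := pow_div hp h7 n h3
      refine ⟨(p * bernoulli j) * ((j + k + 1).choose j : ℚ) * t,
        mul_mem (mul_mem (p_bern_mem hp (by omega) j) (natCast_mem _ _)) ht, ?_⟩
      have : (p : ℚ) ^ (n + 1) / (n + 1) = (p : ℚ) ^ 2 * ((p : ℚ) ^ (n - 1) / (n + 1)) := by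
        rw [show n + 1 = 2 + (n - 1) by omega, pow_add]; ring
      rw [this, hte]; ring
  choose! t ht hte using key
  refine ⟨∑ j ∈ Finset.range i, t j, sum_mem ht, ?_⟩
  rw [sum_range_pow, Finset.sum_range_succ, Finset.sum_congr rfl hte, Finset.mul_sum, add_comm]
  congr 1
  have : (i : ℚ) + 1 ≠ 0 := by positivity
  rw [show i + 1 - i = 1 by omega, Nat.choose_succ_self_right]
  push_cast
  field_simp

lemma expand (r x : ℤ) (m : ℕ) : ∃ t : ℤ, (r + x) ^ (m + 2) =
    r ^ (m + 2) + (m + 2) * x * r ^ (m + 1) + ((m + 2).choose 2 : ℕ) * x ^ 2 * (r + x) ^ m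
      + x ^ 3 * t := by
  induction m with
  | zero => exact ⟨0, by norm_num; ring⟩
  | succ m ih =>
    obtain ⟨t, ht⟩ := ih
    obtain ⟨s, hs⟩ := sub_dvd_pow_sub_pow (r + x) r (m + 1)
    refine ⟨t * (r + x) - (m + 2) * s, ?_⟩
    have hc : (m + 1 + 2).choose 2 = (m + 2) + (m + 2).choose 2 := by
      rw [show m + 1 + 2 = (m + 2) + 1 by ring, Nat.choose_succ_succ' (m + 2) 1]; simp
    rw [show m + 1 + 2 = (m + 2) + 1 by ring] at *
    rw [pow_succ (r + x) (m + 2), ht, hc]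
    have hs' : r ^ (m + 1) = (r + x) ^ (m + 1) - x * s := by linarith [hs, show (r + x - r) * s = x * s by ring]
    push_cast
    have : (m + 2 : ℤ) * x ^ 2 * r ^ (m + 1) = (m + 2) * x ^ 2 * ((r + x) ^ (m + 1) - x * s) := by
      rw [hs']
    linear_combination this

lemma perm {p : ℕ} (hp : p.Prime) (a : ℕ) (ha : ¬ p ∣ a) (f : ℕ → ℤ) :
    ∑ b ∈ Finset.Icc 1 (p - 1), f (a * b % p) = ∑ b ∈ Finset.Icc 1 (p - 1), f b := by
  have hp2 := hp.two_le
  have hmaps : ∀ b ∈ Finset.Icc 1 (p - 1), a * b % p ∈ Finset.Icc 1 (p - 1) := by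
    intro b hb
    rw [Finset.mem_Icc] at *
    have h1 : a * b % p < p := Nat.mod_lt _ hp.pos
    have h2 : a * b % p ≠ 0 := by
      intro h
      rcases (Nat.Prime.dvd_mul hp).1 (Nat.dvd_of_mod_eq_zero h) with h | h
      · exact ha h
      · have := Nat.le_of_dvd (by omega) h; omega
    omega
  have hinj : Set.InjOn (fun b => a * b % p) (Finset.Icc 1 (p - 1) : Finset ℕ) := by
    intro b hb c hc h
    simp only [Finset.coe_Icc, Set.mem_Icc] at hb hc
    have h' : a * b ≡ a * c [MOD p] := h
    have := Nat.ModEq.cancel_left_of_coprime ((Nat.Prime.coprime_iff_not_dvd hp).2 ha) h'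
    exact Nat.ModEq.eq_of_lt_of_lt this (by omega) (by omega)
  have himg : (Finset.Icc 1 (p - 1)).image (fun b => a * b % p) = Finset.Icc 1 (p - 1) := by
    apply Finset.eq_of_subset_of_card_le
    · intro x hx
      obtain ⟨b, hb, rfl⟩ := Finset.mem_image.1 hx
      exact hmaps b hb
    · rw [Finset.card_image_of_injOn hinj]
  conv_rhs => rw [← himg]
  rw [Finset.sum_image hinj]

lemma main_int {p : ℕ} (hp : p.Prime) (a : ℕ) (ha : ¬ p ∣ a) (m : ℕ) :
    ∃ T : ℤ, ((a : ℤ) ^ (m + 2) - 1) * ∑ b ∈ Finset.Icc 1 (p - 1), (b : ℤ) ^ (m + 2) =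
      (m + 2) * p * (∑ b ∈ Finset.Icc 1 (p - 1),
          ((a * b / p : ℕ) : ℤ) * ((a * b % p : ℕ) : ℤ) ^ (m + 1))
        + ((m + 2).choose 2 : ℕ) * (p : ℤ) ^ 2 * (a : ℤ) ^ m *
            (∑ b ∈ Finset.Icc 1 (p - 1), ((a * b / p : ℕ) : ℤ) ^ 2 * (b : ℤ) ^ m)
        + (p : ℤ) ^ 3 * T := by
  choose t ht using fun b : ℕ =>
    expand ((a * b % p : ℕ) : ℤ) ((p : ℤ) * ((a * b / p : ℕ) : ℤ)) m
  refine ⟨∑ b ∈ Finset.Icc 1 (p - 1), ((a * b / p : ℕ) : ℤ) ^ 3 * t b, ?_⟩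
  have hperm := perm hp a ha (fun x => (x : ℤ) ^ (m + 2))
  rw [sub_mul, one_mul]
  conv_lhs => rw [sub_eq_add_neg]; rhs; rw [← hperm]
  rw [← sub_eq_add_neg]
  rw [Finset.mul_sum, Finset.mul_sum, Finset.mul_sum, Finset.mul_sum, ← Finset.sum_sub_distrib,
    ← Finset.sum_add_distrib, ← Finset.sum_add_distrib]
  refine Finset.sum_congr rfl fun b _ => ?_
  have hb := ht b
  have e : ((a * b % p : ℕ) : ℤ) + (p : ℤ) * ((a * b / p : ℕ) : ℤ) = a * b := by
    exact_mod_cast Nat.mod_add_div (a * b) p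
  rw [e, mul_pow, mul_pow] at hb
  linear_combination hb

end VorSharp

/-- sharpened Voronoi congruence modulo `p²`, even case. -/
theorem voronoi_sharpened_even (p : ℕ) (hp : p.Prime) (hodd : Odd p)
    (a : ℕ) (ha1 : 1 ≤ a) (ha2 : a ≤ p - 1)
    (i : ℕ) (hipos : 0 < i) (hieven : Even i) (hcop : Nat.Coprime i p)
    (h0 : ¬ i ≡ 0 [MOD p - 1]) (h2 : ¬ i ≡ 2 [MOD p - 1]) :
    ratCongr p 2 (((a : ℚ) ^ i - 1) * bernoulli i / i)
      ((∑ b ∈ Finset.Icc 1 (p - 1),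
          ((a * b / p : ℕ) : ℚ) * ((a * b % p : ℕ) : ℚ) ^ (i - 1))
        + (p : ℚ) * (((i : ℚ) - 1) / 2) * (a : ℚ) ^ (i - 2) *
            ∑ b ∈ Finset.Icc 1 (p - 1),
              ((a * b / p : ℕ) : ℚ) ^ 2 * (b : ℚ) ^ (i - 2)) := by
  have hp2 := hp.two_le
  have h7 : 7 ≤ p := by
    by_contra hcon
    obtain ⟨c, hc⟩ := hieven
    obtain ⟨d, hd⟩ := hodd
    obtain h | h : p = 3 ∨ p = 5 := by omega
    · subst h
      apply h0
      simp only [Nat.ModEq]; omega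
    · subst h
      simp only [Nat.ModEq] at h0 h2
      omega
  have hi4 : 4 ≤ i := by
    obtain ⟨c, hc⟩ := hieven
    by_contra hcon
    obtain rfl : i = 2 := by omega
    exact h2 rfl
  have hdvd2 : ¬ (p - 1) ∣ (i - 2) := fun h =>
    h2 ((Nat.modEq_iff_dvd' (by omega : 2 ≤ i)).2 h).symm
  have ha : ¬ p ∣ a := fun h => by have := Nat.le_of_dvd ha1 h; omega
  have hpi : ¬ p ∣ i := (Nat.Prime.coprime_iff_not_dvd hp).1 hcop.symm
  obtain ⟨t, ht, hS⟩ := VorSharp.sum_pow hp h7 i hi4 hieven hdvd2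
  have hrange : ∑ b ∈ Finset.range p, (b : ℚ) ^ i = ∑ b ∈ Finset.Icc 1 (p - 1), (b : ℚ) ^ i := by
    rw [Finset.range_eq_Ico, Finset.sum_eq_sum_Ico_succ_bot hp.pos]
    have : Finset.Ico (0 + 1) p = Finset.Icc 1 (p - 1) := by
      ext x; simp only [Finset.mem_Ico, Finset.mem_Icc]; omega
    rw [this]
    simp [hipos.ne']
  rw [hrange] at hS
  obtain ⟨m, rfl⟩ : ∃ m, i = m + 2 := ⟨i - 2, by omega⟩
  obtain ⟨T, hT⟩ := VorSharp.main_int hp a ha m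
  have hT' := congrArg (Int.cast : ℤ → ℚ) hT
  simp only [Int.cast_sum, Int.cast_mul, Int.cast_add, Int.cast_pow, Int.cast_sub, Int.cast_one, Int.cast_natCast, Int.cast_ofNat] at hT'
  rw [hS] at hT'
  refine ⟨(((m + 2 : ℕ) : ℚ))⁻¹ * (T - ((a : ℚ) ^ (m + 2) - 1) * t), ?_,
    mul_mem (VorSharp.inv_mem hp hpi) (sub_mem (intCast_mem _ _)
      (mul_mem (sub_mem (pow_mem (natCast_mem _ _) _) (one_mem _)) ht))⟩
  rw [show m + 2 - 1 = m + 1 by omega, show m + 2 - 2 = m by omega]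
  set S1 := ∑ b ∈ Finset.Icc 1 (p - 1),
          ((a * b / p : ℕ) : ℚ) * ((a * b % p : ℕ) : ℚ) ^ (m + 1)
  set S2 := ∑ b ∈ Finset.Icc 1 (p - 1), ((a * b / p : ℕ) : ℚ) ^ 2 * (b : ℚ) ^ m
  have hc : (((m + 2).choose 2 : ℕ) : ℚ) = (m + 2) * (m + 1) / 2 := by
    rw [Nat.cast_choose_two]; push_cast; ring
  rw [hc] at hT'
  have hp0 : (p : ℚ) ≠ 0 := by exact_mod_cast hp.ne_zero
  have hm0 : (m : ℚ) + 2 ≠ 0 := by positivity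
  push_cast
  field_simp
  apply mul_left_cancel₀ hp0
  linear_combination 2 * hT'
end

section
/- Let p be an odd prime, let a be an integer with 1 ≤ a ≤ p−1, and let i be a positive odd integer with gcd(i,p) = 1, i ≢ 1 (mod p−1) and i ≢ 3 (mod p−1). Then the sum S₁ = Σ_{b=1}^{p−1} ⌊ab/p⌋·r(ab)^{i−1} is divisible by p, and B_{i−1}·(a^i − 1) ≡ 2·S₁/p + (i−1)·Σ_{b=1}^{p−1} ⌊ab/p⌋²·r(ab)^{i−2} + p·((i−1)(i−2)/3)·Σ_{b=1}^{p−1} ⌊ab/p⌋³·r(ab)^{i−3} (mod p²), where r(x) ∈ {0,…,p−1} denotes the least nonnegative residue of x modulo p. -/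
/-- the subring of `p`-integral rationals -/
noncomputable def pInt (p : ℕ) [Fact p.Prime] : Subring ℚ := (Rat.padicValuation p).integer

lemma mem_pInt {p : ℕ} [Fact p.Prime] {x : ℚ} : x ∈ pInt p ↔ ¬ p ∣ x.den := by
  rw [pInt, Valuation.mem_integer_iff, Rat.padicValuation_le_one_iff]

lemma inv_mem_pInt {p : ℕ} [Fact p.Prime] {n : ℕ} (h : ¬ p ∣ n) : ((n : ℚ))⁻¹ ∈ pInt p := by
  rw [mem_pInt]
  have hn : n ≠ 0 := by rintro rfl; simp at h
  rw [Rat.inv_natCast_den_of_pos (Nat.pos_of_ne_zero hn)]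
  exact h

lemma pow_div_mem_pInt {p : ℕ} [Fact p.Prime] {M N : ℕ} (hM : M ≠ 0) (h : M < p ^ (N + 1)) :
    (p : ℚ) ^ N / M ∈ pInt p := by
  have hp : p.Prime := Fact.out
  obtain ⟨e, M', hM', rfl⟩ := Nat.exists_eq_pow_mul_and_not_dvd hM p hp.ne_one
  have hp0 : (p : ℚ) ≠ 0 := by exact_mod_cast hp.ne_zero
  have he : e ≤ N := by
    by_contra hlt
    have h1 : p ^ (N + 1) ≤ p ^ e := Nat.pow_le_pow_right hp.pos (by omega)
    have h2 : p ^ e ≤ p ^ e * M' := Nat.le_mul_of_pos_right _ (Nat.pos_of_ne_zero (by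
      rintro rfl; simp at hM'))
    omega
  obtain ⟨d, rfl⟩ := Nat.exists_eq_add_of_le he
  have : (p : ℚ) ^ (e + d) / ((p ^ e * M' : ℕ) : ℚ) = (p : ℚ) ^ d * (M' : ℚ)⁻¹ := by
    push_cast
    rw [pow_add, mul_div_mul_left _ _ (pow_ne_zero _ hp0), div_eq_mul_inv]
  rw [this]
  exact mul_mem (pow_mem (natCast_mem _ _) _) (inv_mem_pInt hM')

lemma prime_mul_bernoulli_mem {p : ℕ} [Fact p.Prime] (hp2 : p ≠ 2) (n : ℕ) :
    (p : ℚ) * bernoulli n ∈ pInt p := by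
  have hp : p.Prime := Fact.out
  rcases Nat.even_or_odd' n with ⟨k, rfl | rfl⟩
  · obtain ⟨z, hz⟩ := Bernoulli.vonStaudt_clausen k
    rw [eq_sub_iff_add_eq.mpr hz.symm, mul_sub, Finset.mul_sum]
    refine sub_mem (mul_mem (natCast_mem _ _) (intCast_mem _ _)) (sum_mem fun q hq => ?_)
    rw [Finset.mem_filter] at hq
    by_cases h : q = p
    · subst h
      rw [mul_one_div_cancel (by exact_mod_cast hp.ne_zero)]
      exact one_mem _
    · rw [one_div]
      refine mul_mem (natCast_mem _ _) (inv_mem_pInt ?_)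
      rw [Nat.prime_dvd_prime_iff_eq hp hq.2.1]
      exact fun h' => h h'.symm
  · rcases Nat.eq_zero_or_pos k with rfl | hk
    · have : (p : ℚ) * bernoulli (2 * 0 + 1) = -(p * ((2 : ℕ) : ℚ)⁻¹) := by
        simp [bernoulli_one]; ring
      rw [this]
      refine neg_mem (mul_mem (natCast_mem _ _) (inv_mem_pInt ?_))
      rwa [Nat.prime_dvd_prime_iff_eq hp Nat.prime_two]
    · rw [bernoulli_eq_zero_of_odd ⟨k, rfl⟩ (by omega), mul_zero]
      exact zero_mem _

lemma bernoulli_mem {p : ℕ} [Fact p.Prime] {n : ℕ} (hn : Even n) (h : ¬ (p - 1) ∣ n) :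
    bernoulli n ∈ pInt p := by
  have hp : p.Prime := Fact.out
  obtain ⟨k, rfl⟩ := hn.two_dvd
  obtain ⟨z, hz⟩ := Bernoulli.vonStaudt_clausen k
  rw [eq_sub_iff_add_eq.mpr hz.symm]
  refine sub_mem (intCast_mem _ _) (sum_mem fun q hq => ?_)
  rw [Finset.mem_filter] at hq
  rw [one_div]
  refine inv_mem_pInt ?_
  rw [Nat.prime_dvd_prime_iff_eq hp hq.2.1]
  rintro rfl
  exact h hq.2.2

lemma choose_div (i j : ℕ) (hj : j ≤ i) :
    ((i + 1).choose j : ℚ) / (i + 1) = (i.choose j : ℚ) / ((i - j + 1 : ℕ) : ℚ) := by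
  have h := Nat.choose_mul_succ_eq i j
  rw [show i + 1 - j = i - j + 1 by omega] at h
  rw [div_eq_div_iff (by positivity) (by positivity)]
  exact_mod_cast h.symm

lemma power_sum_congr {p : ℕ} [Fact p.Prime] (hp7 : 7 ≤ p) (m : ℕ) (hm : Odd m)
    (h3 : ¬ (p - 1) ∣ m + 1) :
    ∃ t ∈ pInt p, ∑ b ∈ Finset.Icc 1 (p - 1), (b : ℚ) ^ (m + 4) =
      (m + 4) * bernoulli (m + 3) * p ^ 2 / 2 + p ^ 4 * t := by
  have hp : p.Prime := Fact.out
  have hsum : ∑ b ∈ Finset.Icc 1 (p - 1), (b : ℚ) ^ (m + 4)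
      = ∑ b ∈ Finset.range p, (b : ℚ) ^ (m + 4) := by
    have : Finset.range p = insert 0 (Finset.Icc 1 (p - 1)) := by
      ext x; simp; omega
    rw [this, Finset.sum_insert (by simp)]
    simp
  have key : ∀ j ∈ Finset.range (m + 1), ∃ t ∈ pInt p,
      bernoulli j * ((m + 4 + 1).choose j) * (p : ℚ) ^ (m + 4 + 1 - j) / ((m + 4 : ℕ) + 1)
        = p ^ 4 * t := by
    intro j hj
    rw [Finset.mem_range] at hj
    obtain ⟨d, rfl⟩ : ∃ d, m = j + d := ⟨m - j, by omega⟩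
    refine ⟨(p * bernoulli j) * ((j + d + 4).choose j) * ((p : ℚ) ^ d / ((d + 5 : ℕ) : ℚ)),
      mul_mem (mul_mem (prime_mul_bernoulli_mem (by omega) _) (natCast_mem _ _))
        (pow_div_mem_pInt (by omega) ?_), ?_⟩
    · calc d + 5 < 7 ^ (d + 1) := by
            clear * -
            induction d with
            | zero => norm_num
            | succ d ih => rw [pow_succ]; omega
        _ ≤ p ^ (d + 1) := Nat.pow_le_pow_left hp7 _
    · have hc := choose_div (j + d + 4) j (by omega)
      rw [show j + d + 4 - j + 1 = d + 5 by omega] at hc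
      rw [show j + d + 4 + 1 - j = d + 5 by omega]
      calc _ = bernoulli j * (p : ℚ) ^ (d + 5) *
            (((j + d + 4 + 1).choose j : ℚ) / ((j + d + 4 : ℕ) + 1)) := by ring
        _ = _ := by rw [hc]; ring
  choose! f hf1 hf2 using key
  have hB1 : bernoulli (m + 2) = 0 := by
    refine bernoulli_eq_zero_of_odd ?_ (by omega)
    rw [Nat.odd_iff] at *; omega
  have hB2 : bernoulli (m + 4) = 0 := by
    refine bernoulli_eq_zero_of_odd ?_ (by omega)
    rw [Nat.odd_iff] at *; omega
  have h4 : ¬ p ∣ 4 := fun h => absurd (Nat.le_of_dvd (by norm_num) h) (by omega)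
  refine ⟨∑ j ∈ Finset.range (m + 1), f j +
    bernoulli (m + 1) * ((m + 4).choose (m + 1)) * ((4 : ℕ) : ℚ)⁻¹,
    add_mem (sum_mem hf1) (mul_mem (mul_mem (bernoulli_mem hm.add_one h3) (natCast_mem _ _))
      (inv_mem_pInt h4)), ?_⟩
  rw [hsum, sum_range_pow]
  rw [Finset.sum_range_succ, Finset.sum_range_succ, Finset.sum_range_succ, Finset.sum_range_succ,
    Finset.sum_congr rfl hf2, ← Finset.mul_sum, hB1, hB2]
  have hc1 := choose_div (m + 4) (m + 1) (by omega)
  have hc3 := choose_div (m + 4) (m + 3) (by omega)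
  rw [show m + 4 - (m + 1) + 1 = 4 by omega] at hc1
  rw [show m + 4 - (m + 3) + 1 = 2 by omega, Nat.choose_succ_self_right (m + 3)] at hc3
  rw [show m + 4 + 1 - (m + 1) = 4 by omega, show m + 4 + 1 - (m + 3) = 2 by omega]
  have e1 : bernoulli (m + 1) * ((m + 4 + 1).choose (m + 1)) * (p : ℚ) ^ 4 / ((m + 4 : ℕ) + 1)
      = p ^ 4 * (bernoulli (m + 1) * ((m + 4).choose (m + 1)) * ((4 : ℕ) : ℚ)⁻¹) := by
    calc _ = bernoulli (m + 1) * (p : ℚ) ^ 4 *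
          (((m + 4 + 1).choose (m + 1) : ℚ) / ((m + 4 : ℕ) + 1)) := by ring
      _ = _ := by rw [hc1]; ring
  have e3 : bernoulli (m + 3) * ((m + 4 + 1).choose (m + 3)) * (p : ℚ) ^ 2 / ((m + 4 : ℕ) + 1)
      = (m + 4) * bernoulli (m + 3) * p ^ 2 / 2 := by
    calc _ = bernoulli (m + 3) * (p : ℚ) ^ 2 *
          (((m + 4 + 1).choose (m + 3) : ℚ) / ((m + 4 : ℕ) + 1)) := by ring
      _ = _ := by rw [hc3]; push_cast; ring
  rw [e1, e3]
  ring

lemma binom_expand (R : Subring ℚ) (h6 : (6 : ℚ)⁻¹ ∈ R) {x y : ℚ} (hx : x ∈ R) (hy : y ∈ R)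
    (n : ℕ) : ∃ z ∈ R, (x + y) ^ (n + 3) = y ^ (n + 3) + (n + 3) * x * y ^ (n + 2)
      + (n + 3) * (n + 2) / 2 * x ^ 2 * y ^ (n + 1)
      + (n + 3) * (n + 2) * (n + 1) / 6 * x ^ 3 * y ^ n + x ^ 4 * z := by
  induction n with
  | zero => exact ⟨0, zero_mem _, by simp; ring⟩
  | succ n ih =>
    obtain ⟨z, hz, h⟩ := ih
    refine ⟨z * (x + y) + ((n + 3 : ℕ) : ℚ) * ((n + 2 : ℕ) : ℚ) * ((n + 1 : ℕ) : ℚ) * 6⁻¹ * y ^ n,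
      add_mem (mul_mem hz (add_mem hx hy)) (mul_mem (mul_mem (mul_mem (mul_mem (natCast_mem _ _)
        (natCast_mem _ _)) (natCast_mem _ _)) h6) (pow_mem hy _)), ?_⟩
    rw [show n + 1 + 3 = (n + 3) + 1 by ring, pow_succ (x + y), h]
    push_cast
    ring

lemma sum_residue {p : ℕ} [Fact p.Prime] {a : ℕ} (ha : ¬ p ∣ a) (f : ℕ → ℚ) :
    ∑ b ∈ Finset.Icc 1 (p - 1), f (a * b % p) = ∑ b ∈ Finset.Icc 1 (p - 1), f b := by
  have hp : p.Prime := Fact.out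
  have hmaps : ∀ b ∈ Finset.Icc 1 (p - 1), a * b % p ∈ Finset.Icc 1 (p - 1) := by
    intro b hb
    rw [Finset.mem_Icc] at *
    have h1 : a * b % p < p := Nat.mod_lt _ hp.pos
    have h2 : a * b % p ≠ 0 := by
      intro h
      rcases hp.dvd_mul.mp (Nat.dvd_of_mod_eq_zero h) with h | h
      · exact ha h
      · have := Nat.le_of_dvd (by omega) h
        omega
    omega
  have hinj : Set.InjOn (fun b => a * b % p) (Finset.Icc 1 (p - 1) : Finset ℕ) := by
    intro b hb c hc h
    simp only [Finset.coe_Icc, Set.mem_Icc] at hb hc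
    have h' : a * b ≡ a * c [MOD p] := h
    have := Nat.ModEq.cancel_left_of_coprime ((Nat.Prime.coprime_iff_not_dvd hp).mpr ha) h'
    exact Nat.ModEq.eq_of_lt_of_lt this (by omega) (by omega)
  exact Finset.sum_nbij (fun b => a * b % p) hmaps hinj
    (Finset.surjOn_of_injOn_of_card_le _ hmaps hinj le_rfl) (fun _ _ => rfl)

/-- sharpened Voronoi congruence modulo `p²`, odd case. -/
theorem voronoi_sharpened_odd (p : ℕ) (hp : p.Prime) (hodd : Odd p)
    (a : ℕ) (ha1 : 1 ≤ a) (ha2 : a ≤ p - 1)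
    (i : ℕ) (hipos : 0 < i) (hiodd : Odd i) (hcop : Nat.Coprime i p)
    (h1 : ¬ i ≡ 1 [MOD p - 1]) (h3 : ¬ i ≡ 3 [MOD p - 1]) :
    (p : ℤ) ∣ (∑ b ∈ Finset.Icc 1 (p - 1),
        ((a * b / p : ℕ) : ℤ) * ((a * b % p : ℕ) : ℤ) ^ (i - 1)) ∧
    ratCongr p 2 ((bernoulli (i - 1)) * ((a : ℚ) ^ i - 1))
      (2 * ((∑ b ∈ Finset.Icc 1 (p - 1),
              ((a * b / p : ℕ) : ℤ) * ((a * b % p : ℕ) : ℤ) ^ (i - 1) : ℤ) : ℚ) / p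
        + ((i : ℚ) - 1) *
            ∑ b ∈ Finset.Icc 1 (p - 1),
              ((a * b / p : ℕ) : ℚ) ^ 2 * ((a * b % p : ℕ) : ℚ) ^ (i - 2)
        + (p : ℚ) * (((i : ℚ) - 1) * ((i : ℚ) - 2) / 3) *
            ∑ b ∈ Finset.Icc 1 (p - 1),
              ((a * b / p : ℕ) : ℚ) ^ 3 * ((a * b % p : ℕ) : ℚ) ^ (i - 3)) := by


  have : Fact p.Prime := ⟨hp⟩
  have hp2 := hp.two_le
  -- basic size facts
  obtain ⟨c, hc⟩ := hodd
  have hp7 : 7 ≤ p := by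
    by_contra hlt
    have : p ≠ 6 := by omega
    have h35 : p = 3 ∨ p = 5 := by
      have : p < 7 := by omega
      omega
    obtain ⟨k, hk⟩ := hiodd
    simp only [Nat.ModEq] at h1 h3
    rcases h35 with rfl | rfl <;> omega
  have hi1 : i ≠ 1 := by rintro rfl; exact h1 rfl
  have hi3 : i ≠ 3 := by rintro rfl; exact h3 rfl
  obtain ⟨m, rfl⟩ : ∃ m, i = m + 4 := ⟨i - 4, by obtain ⟨k, hk⟩ := hiodd; omega⟩
  have hm : Odd m := by rw [Nat.odd_iff] at *; omega
  have hd1 : ¬ (p - 1) ∣ m + 1 := by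
    intro h
    exact h3 ((Nat.modEq_iff_dvd' (by omega)).mpr (by simpa using h)).symm
  have hd3 : ¬ (p - 1) ∣ m + 3 := by
    intro h
    exact h1 ((Nat.modEq_iff_dvd' (by omega)).mpr (by simpa using h)).symm
  have ha : ¬ p ∣ a := fun h => absurd (Nat.le_of_dvd (by omega) h) (by omega)
  have hp0 : (p : ℚ) ≠ 0 := by exact_mod_cast hp.ne_zero
  have hnd : ∀ n, 0 < n → n < 7 → ¬ p ∣ n :=
    fun n h0 h7 h => absurd (Nat.le_of_dvd h0 h) (by omega)
  have h6nd : ((6 : ℕ) : ℚ)⁻¹ ∈ pInt p := inv_mem_pInt (hnd 6 (by norm_num) (by norm_num))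
  have h2nd : ((2 : ℕ) : ℚ)⁻¹ ∈ pInt p := inv_mem_pInt (hnd 2 (by norm_num) (by norm_num))
  have h3nd : ((3 : ℕ) : ℚ)⁻¹ ∈ pInt p := inv_mem_pInt (hnd 3 (by norm_num) (by norm_num))
  have hind : ((m + 4 : ℕ) : ℚ)⁻¹ ∈ pInt p :=
    inv_mem_pInt ((Nat.Prime.coprime_iff_not_dvd hp).mp hcop.symm)
  have hine : ((m : ℚ) + 4) ≠ 0 := by positivity
  obtain ⟨t, ht, hT⟩ := power_sum_congr hp7 m hm hd1
  -- binomial expansion of each term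
  have hexp : ∀ b ∈ Finset.Icc 1 (p - 1), ∃ z ∈ pInt p,
      (a : ℚ) ^ (m + 4) * (b : ℚ) ^ (m + 4) = ((a * b % p : ℕ) : ℚ) ^ (m + 4)
        + (m + 4) * p * (((a * b / p : ℕ) : ℚ) * ((a * b % p : ℕ) : ℚ) ^ (m + 3))
        + (m + 4) * (m + 3) / 2 * p ^ 2 *
          (((a * b / p : ℕ) : ℚ) ^ 2 * ((a * b % p : ℕ) : ℚ) ^ (m + 2))
        + (m + 4) * (m + 3) * (m + 2) / 6 * p ^ 3 *
          (((a * b / p : ℕ) : ℚ) ^ 3 * ((a * b % p : ℕ) : ℚ) ^ (m + 1)) + p ^ 4 * z := by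
    intro b _
    obtain ⟨z, hz, h⟩ := binom_expand (pInt p) (by exact_mod_cast h6nd)
      (x := p * ((a * b / p : ℕ) : ℚ)) (y := ((a * b % p : ℕ) : ℚ))
      (mul_mem (natCast_mem _ _) (natCast_mem _ _)) (natCast_mem _ _) (m + 1)
    have hab : (p : ℚ) * ((a * b / p : ℕ) : ℚ) + ((a * b % p : ℕ) : ℚ) = a * b := by
      exact_mod_cast Nat.div_add_mod (a * b) p
    refine ⟨((a * b / p : ℕ) : ℚ) ^ 4 * z, mul_mem (pow_mem (natCast_mem _ _) _) hz, ?_⟩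
    rw [← mul_pow, ← hab, show m + 4 = m + 1 + 3 by ring, h]
    push_cast
    ring
  choose! Z hZ1 hZ2 using hexp
  have hsum := Finset.sum_congr rfl hZ2
  rw [← Finset.mul_sum, Finset.sum_add_distrib, Finset.sum_add_distrib, Finset.sum_add_distrib,
    Finset.sum_add_distrib, ← Finset.mul_sum, ← Finset.mul_sum, ← Finset.mul_sum, ← Finset.mul_sum,
    sum_residue ha (fun n => (n : ℚ) ^ (m + 4)), hT] at hsum
  have hZ : ∑ b ∈ Finset.Icc 1 (p - 1), Z b ∈ pInt p := sum_mem hZ1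
  have hS1 : ((∑ b ∈ Finset.Icc 1 (p - 1),
      ((a * b / p : ℕ) : ℤ) * ((a * b % p : ℕ) : ℤ) ^ (m + 4 - 1) : ℤ) : ℚ) =
      ∑ b ∈ Finset.Icc 1 (p - 1),
        ((a * b / p : ℕ) : ℚ) * ((a * b % p : ℕ) : ℚ) ^ (m + 3) := by
    rw [Int.cast_sum]
    refine Finset.sum_congr rfl fun b _ => ?_
    rw [show m + 4 - 1 = m + 3 by omega]
    simp only [Int.cast_mul, Int.cast_pow, Int.cast_natCast]
  have hM2 : ∑ b ∈ Finset.Icc 1 (p - 1),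
      ((a * b / p : ℕ) : ℚ) ^ 2 * ((a * b % p : ℕ) : ℚ) ^ (m + 2) ∈ pInt p :=
    sum_mem fun b _ => mul_mem (pow_mem (natCast_mem _ _) _) (pow_mem (natCast_mem _ _) _)
  have hM3 : ∑ b ∈ Finset.Icc 1 (p - 1),
      ((a * b / p : ℕ) : ℚ) ^ 3 * ((a * b % p : ℕ) : ℚ) ^ (m + 1) ∈ pInt p :=
    sum_mem fun b _ => mul_mem (pow_mem (natCast_mem _ _) _) (pow_mem (natCast_mem _ _) _)
  rw [hS1]
  rw [show m + 4 - 1 = m + 3 by omega, show m + 4 - 2 = m + 2 by omega,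
    show m + 4 - 3 = m + 1 by omega] at *
  generalize hS1d : (∑ b ∈ Finset.Icc 1 (p - 1),
    ((a * b / p : ℕ) : ℤ) * ((a * b % p : ℕ) : ℤ) ^ (m + 3)) = S at *
  generalize ∑ b ∈ Finset.Icc 1 (p - 1),
        ((a * b / p : ℕ) : ℚ) * ((a * b % p : ℕ) : ℚ) ^ (m + 3) = S1 at *
  generalize ∑ b ∈ Finset.Icc 1 (p - 1),
      ((a * b / p : ℕ) : ℚ) ^ 2 * ((a * b % p : ℕ) : ℚ) ^ (m + 2) = S2 at *
  generalize ∑ b ∈ Finset.Icc 1 (p - 1),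
      ((a * b / p : ℕ) : ℚ) ^ 3 * ((a * b % p : ℕ) : ℚ) ^ (m + 1) = S3 at *
  generalize ∑ b ∈ Finset.Icc 1 (p - 1), Z b = W at *
  have hB : bernoulli (m + 3) ∈ pInt p :=
    bernoulli_mem (by rw [Nat.odd_iff] at hm; rw [Nat.even_iff]; omega) hd3
  generalize bernoulli (m + 3) = B at *
  have haR : (a : ℚ) ^ (m + 4) ∈ pInt p := pow_mem (natCast_mem _ _) _
  generalize (a : ℚ) ^ (m + 4) = A at *
  -- the quotient
  have hu : 2 * ((m + 4 : ℕ) : ℚ)⁻¹ * (W - (A - 1) * t) ∈ pInt p :=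
    mul_mem (mul_mem (by exact_mod_cast natCast_mem (pInt p) 2) hind)
      (sub_mem hZ (mul_mem (sub_mem haR (one_mem _)) ht))
  have heq : B * (A - 1) - (2 * S1 / p + (((m + 4 : ℕ) : ℚ) - 1) * S2
      + p * ((((m + 4 : ℕ) : ℚ) - 1) * (((m + 4 : ℕ) : ℚ) - 2) / 3) * S3)
      = (p : ℚ) ^ 2 * (2 * ((m + 4 : ℕ) : ℚ)⁻¹ * (W - (A - 1) * t)) := by
    push_cast
    have hne : ((m : ℚ) + 4) * p ^ 2 / 2 ≠ 0 := by positivity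
    apply mul_left_cancel₀ hne
    field_simp
    apply mul_left_cancel₀ hp0
    linear_combination 6 * hsum
  refine ⟨?_, _, heq, mem_pInt.mp hu⟩
  generalize 2 * ((m + 4 : ℕ) : ℚ)⁻¹ * (W - (A - 1) * t) = u at *
  have hw : (S : ℚ) / p ∈ pInt p := by
    have : (S : ℚ) / p = ((2 : ℕ) : ℚ)⁻¹ * (B * (A - 1) - ((m + 3 : ℕ) : ℚ) * S2
      - p * (((m + 3 : ℕ) : ℚ) * ((m + 2 : ℕ) : ℚ) * ((3 : ℕ) : ℚ)⁻¹) * S3 - p ^ 2 * u) := by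
      rw [hS1]
      push_cast at heq ⊢
      linear_combination (-1 / 2 : ℚ) * heq
    rw [this]
    have hn : ∀ n : ℕ, (n : ℚ) ∈ pInt p := natCast_mem _
    exact mul_mem h2nd (sub_mem (sub_mem (sub_mem (mul_mem hB (sub_mem haR (one_mem _)))
      (mul_mem (hn _) hM2)) (mul_mem (mul_mem (hn _) (mul_mem (mul_mem (hn _) (hn _)) h3nd)) hM3))
      (mul_mem (pow_mem (hn _) _) hu))
  rw [mem_pInt] at hw
  set w : ℚ := (S : ℚ) / p with hwd
  have hz : S * (w.den : ℤ) = p * w.num := by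
    have h1 : (S : ℚ) = p * w := by rw [hwd]; field_simp
    have h2 : w * w.den = w.num := Rat.mul_den_eq_num w
    have : (S : ℚ) * w.den = p * w.num := by rw [← h2]; rw [h1]; ring
    exact_mod_cast this
  have hdvd : (p : ℤ) ∣ S * (w.den : ℤ) := ⟨_, hz⟩
  rcases (Nat.prime_iff_prime_int.mp hp).dvd_or_dvd hdvd with h | h
  · exact h
  · exact absurd (by exact_mod_cast h) hw
end

section
/- Let p be an odd prime, let i be a positive even integer with gcd(i,p) = 1, i ≢ 0 (mod p−1) and i ≢ 2 (mod p−1), and let a be an integer with 2 ≤ a ≤ p−1. Then 2·(a^i − 1)·B_i/i ≡ Σ_{b=1}^{p−1} ((ab)^{i−1} + r(ab)^{i−1})·⌊ab/p⌋ (mod p²), where r(x) ∈ {0,…,p−1} denotes the least nonnegative residue of x modulo p. -/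
/-- The ring of `p`-integral rationals. -/
noncomputable def vR (p : ℕ) [Fact p.Prime] : Subring ℚ := (Rat.padicValuation p).integer

theorem mem_vR {p : ℕ} [Fact p.Prime] {x : ℚ} : x ∈ vR p ↔ ¬ p ∣ x.den := by
  rw [← Rat.padicValuation_le_one_iff]; rfl

theorem nat_mem_vR {p : ℕ} [Fact p.Prime] (n : ℕ) : (n : ℚ) ∈ vR p := natCast_mem _ n

theorem inv_mem_vR {p : ℕ} [Fact p.Prime] {n : ℕ} (h : ¬ p ∣ n) : (1 / (n : ℚ)) ∈ vR p := by
  rw [mem_vR]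
  have hn : n ≠ 0 := by rintro rfl; simp at h
  simpa [hn] using h

theorem p_div_mem_vR {p : ℕ} [hp : Fact p.Prime] {q : ℕ} (hq : q.Prime) :
    (p : ℚ) * (1 / (q : ℚ)) ∈ vR p := by
  by_cases h : p = q
  · subst h
    have : (p : ℚ) ≠ 0 := by exact_mod_cast hq.ne_zero
    rw [mul_one_div_cancel this]; exact one_mem _
  · exact mul_mem (nat_mem_vR _) (inv_mem_vR (fun hd => h ((Nat.prime_dvd_prime_iff_eq hp.out hq).1 hd)))

theorem p_bernoulli_mem {p : ℕ} [hp : Fact p.Prime] (hp2 : p ≠ 2) (n : ℕ) :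
    (p : ℚ) * bernoulli n ∈ vR p := by
  rcases Nat.even_or_odd' n with ⟨k, rfl | rfl⟩
  · obtain ⟨z, hz⟩ := Bernoulli.vonStaudt_clausen k
    rw [eq_sub_of_add_eq hz.symm, mul_sub, Finset.mul_sum]
    refine sub_mem (mul_mem (nat_mem_vR _) (intCast_mem _ z)) (sum_mem ?_)
    intro q hq
    exact p_div_mem_vR (Finset.mem_filter.1 hq).2.1
  · rcases Nat.eq_zero_or_pos k with rfl | hk
    · have h2 : ¬ p ∣ 2 := fun hd => hp2 ((Nat.prime_dvd_prime_iff_eq hp.out Nat.prime_two).1 hd)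
      have := inv_mem_vR h2
      have h := mul_mem (nat_mem_vR (p := p) p) (neg_mem this)
      norm_num [bernoulli_one] at h ⊢
      exact h
    · rw [bernoulli_eq_zero_of_odd ⟨k, rfl⟩ (by omega), mul_zero]
      exact zero_mem _

theorem bernoulli_mem_s3 {p : ℕ} [hp : Fact p.Prime] (k : ℕ) (h : ¬ (p - 1) ∣ 2 * k) :
    bernoulli (2 * k) ∈ vR p := by
  obtain ⟨z, hz⟩ := Bernoulli.vonStaudt_clausen k
  rw [eq_sub_of_add_eq hz.symm]
  refine sub_mem (intCast_mem _ z) (sum_mem ?_)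
  intro q hq
  have hq := (Finset.mem_filter.1 hq).2
  refine inv_mem_vR (fun hd => ?_)
  rw [← (Nat.prime_dvd_prime_iff_eq hp.out hq.1).1 hd] at hq
  exact h hq.2

theorem pow_div_mem {p : ℕ} [hp : Fact p.Prime] (hp7 : 7 ≤ p) (k : ℕ) :
    (p : ℚ) ^ k / ((k + 4 : ℕ) : ℚ) ∈ vR p := by
  obtain ⟨e, m, hm, he⟩ := Nat.exists_eq_pow_mul_and_not_dvd (n := k + 4) (by omega) p hp.out.ne_one
  have hek : e ≤ k := by
    rcases Nat.eq_zero_or_pos e with rfl | h0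
    · omega
    · have h1 : 7 ^ e ≤ p ^ e := Nat.pow_le_pow_left hp7 e
      have hm0 : 0 < m := Nat.pos_of_ne_zero (by rintro rfl; simp at hm)
      have h2 : p ^ e ≤ k + 4 := by rw [he]; exact Nat.le_mul_of_pos_right _ hm0
      have h3 : e + 4 ≤ 7 ^ e := by
        clear * - h0
        induction e, h0 using Nat.le_induction with
        | base => norm_num
        | succ n _ ih => rw [pow_succ]; omega
      omega
  have hp0 : (p : ℚ) ≠ 0 := by exact_mod_cast hp.out.ne_zero
  have hm0 : (m : ℚ) ≠ 0 := by
    have : m ≠ 0 := by rintro rfl; simp at hm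
    exact_mod_cast this
  have : (p : ℚ) ^ k / ((k + 4 : ℕ) : ℚ) = (p : ℚ) ^ (k - e) * (1 / (m : ℚ)) := by
    rw [he]
    push_cast
    obtain ⟨d, rfl⟩ := Nat.exists_eq_add_of_le hek
    rw [Nat.add_sub_cancel_left, pow_add]
    field_simp
  rw [this]
  exact mul_mem (pow_mem (nat_mem_vR _) _) (inv_mem_vR hm)

theorem term_mem {p : ℕ} [hp : Fact p.Prime] (hp7 : 7 ≤ p) {i j : ℕ} (hi : Even i)
    (hi2 : 2 < i) (h2 : ¬ (p - 1) ∣ i - 2) (hj : j < i) :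
    ∃ u ∈ vR p, bernoulli j * ((i + 1).choose j : ℚ) * (p : ℚ) ^ (i + 1 - j) / ((i : ℚ) + 1)
      = (p : ℚ) ^ 3 * u := by
  obtain ⟨k, rfl⟩ : ∃ k, i = j + (k + 1) := ⟨i - j - 1, by omega⟩
  have hch : ((j + (k + 1) + 1).choose j : ℚ) / (((j + (k + 1) : ℕ) : ℚ) + 1)
      = ((j + (k + 1)).choose j : ℚ) / ((k + 2 : ℕ) : ℚ) := by
    have h := Nat.choose_mul_succ_eq (j + (k + 1)) j
    rw [show j + (k + 1) + 1 - j = k + 2 by omega] at h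
    have h' : ((j + (k + 1)).choose j : ℚ) * (((j + (k + 1) : ℕ) : ℚ) + 1)
      = ((j + (k + 1) + 1).choose j : ℚ) * ((k + 2 : ℕ) : ℚ) := by exact_mod_cast h
    rw [div_eq_div_iff (by positivity) (by positivity)]
    exact h'.symm
  have e : bernoulli j * ((j + (k + 1) + 1).choose j : ℚ) * (p : ℚ) ^ (j + (k + 1) + 1 - j)
      / (((j + (k + 1) : ℕ) : ℚ) + 1) =
      bernoulli j * ((j + (k + 1)).choose j : ℚ) * (p : ℚ) ^ (k + 2) / ((k + 2 : ℕ) : ℚ) := by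
    rw [show j + (k + 1) + 1 - j = k + 2 by omega, mul_right_comm, mul_div_assoc, hch]
    ring
  rw [e]
  match k with
  | 0 =>
    refine ⟨0, zero_mem _, ?_⟩
    rw [bernoulli_eq_zero_of_odd (by grind) (by omega)]; simp
  | 1 =>
    refine ⟨bernoulli j * ((j + 2).choose j : ℚ) * (1 / ((3 : ℕ) : ℚ)), ?_, by push_cast; ring⟩
    refine mul_mem (mul_mem ?_ (nat_mem_vR _)) (inv_mem_vR ?_)
    · obtain ⟨m, rfl⟩ : ∃ m, j = 2 * m := ⟨j / 2, by grind⟩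
      exact bernoulli_mem_s3 m (by simpa using h2)
    · intro hd; have := Nat.le_of_dvd (by norm_num) hd; omega
  | k + 2 =>
    refine ⟨(p * bernoulli j) * ((j + (k + 2 + 1)).choose j : ℚ) * ((p : ℚ) ^ k / ((k + 4 : ℕ) : ℚ)),
      mul_mem (mul_mem (p_bernoulli_mem (by omega) j) (nat_mem_vR _)) (pow_div_mem hp7 k), ?_⟩
    rw [show k + 2 + 2 = k + 4 by omega]
    ring

theorem sum_eq {p : ℕ} [hp : Fact p.Prime] (hp7 : 7 ≤ p) {i : ℕ} (hi : Even i)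
    (hi2 : 2 < i) (h2 : ¬ (p - 1) ∣ i - 2) :
    ∃ u ∈ vR p, ∑ b ∈ Finset.Icc 1 (p - 1), (b : ℚ) ^ i = p * bernoulli i + (p : ℚ) ^ 3 * u := by
  have h := sum_range_pow p i
  have hs : ∑ b ∈ Finset.Icc 1 (p - 1), (b : ℚ) ^ i = ∑ b ∈ Finset.range p, (b : ℚ) ^ i := by
    refine Finset.sum_subset (fun b hb => ?_) (fun b hb hb' => ?_)
    · simp at hb ⊢; omega
    · simp at hb hb'
      have : b = 0 := by omega
      subst this
      simp; omega
  rw [hs, h, Finset.sum_range_succ]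
  have : ∀ j ∈ Finset.range i, ∃ u ∈ vR p,
      bernoulli j * ((i + 1).choose j : ℚ) * (p : ℚ) ^ (i + 1 - j) / ((i : ℚ) + 1)
      = (p : ℚ) ^ 3 * u := fun j hj => term_mem hp7 hi hi2 h2 (Finset.mem_range.1 hj)
  choose! u hu hu' using this
  refine ⟨∑ j ∈ Finset.range i, u j, sum_mem hu, ?_⟩
  rw [Finset.mul_sum, Finset.sum_congr rfl hu', add_comm]
  congr 1
  have : (i : ℚ) + 1 ≠ 0 := by positivity
  simp [Nat.choose_succ_self_right]
  field_simp

theorem trap1 (y d : ℤ) (n : ℕ) :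
    ∃ c, (y + d) ^ (n + 1) = y ^ (n + 1) + (n + 1) * y ^ n * d + d ^ 2 * c := by
  induction n with
  | zero => exact ⟨0, by simp⟩
  | succ n ih =>
    obtain ⟨c, hc⟩ := ih
    refine ⟨(n + 1) * y ^ n + c * (y + d), ?_⟩
    rw [pow_succ, hc]; push_cast; ring

theorem trap2 (y d : ℤ) (n : ℕ) :
    ∃ c, 2 * (y + d) ^ (n + 2) = 2 * y ^ (n + 2) + 2 * (n + 2) * y ^ (n + 1) * d
      + (n + 2) * (n + 1) * y ^ n * d ^ 2 + d ^ 3 * c := by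
  induction n with
  | zero => exact ⟨0, by simp; ring⟩
  | succ n ih =>
    obtain ⟨c, hc⟩ := ih
    refine ⟨(n + 2) * (n + 1) * y ^ n + c * (y + d), ?_⟩
    rw [pow_succ, ← mul_assoc, hc]; push_cast; ring

theorem trap (y d : ℤ) (n : ℕ) :
    ∃ c, 2 * ((y + d) ^ (n + 2) - y ^ (n + 2)) - (n + 2) * d * ((y + d) ^ (n + 1) + y ^ (n + 1))
      = d ^ 3 * c := by
  obtain ⟨c, hc⟩ := trap1 y d n
  obtain ⟨c', hc'⟩ := trap2 y d n
  refine ⟨c' - (n + 2) * c, ?_⟩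
  rw [mul_sub, hc', hc]; ring

theorem perm_sum {p : ℕ} (hp : p.Prime) {a : ℕ} (ha : ¬ p ∣ a) (f : ℕ → ℚ) :
    ∑ b ∈ Finset.Icc 1 (p - 1), f (a * b % p) = ∑ b ∈ Finset.Icc 1 (p - 1), f b := by
  have hp0 := hp.pos
  have hmaps : ∀ b ∈ Finset.Icc 1 (p - 1), a * b % p ∈ Finset.Icc 1 (p - 1) := by
    intro b hb
    rw [Finset.mem_Icc] at hb ⊢
    have h1 := Nat.mod_lt (a * b) hp0
    have h2 : a * b % p ≠ 0 := fun h => by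
      rcases hp.dvd_mul.1 (Nat.dvd_of_mod_eq_zero h) with h | h
      · exact ha h
      · have := Nat.le_of_dvd (by omega) h; omega
    omega
  have hinj : Set.InjOn (fun b => a * b % p) (Finset.Icc 1 (p - 1) : Finset ℕ) := by
    intro b hb c hc h
    simp only [Finset.coe_Icc, Set.mem_Icc] at hb hc
    have h' : a * b ≡ a * c [MOD p] := h
    have := Nat.ModEq.cancel_left_of_coprime ((Nat.Prime.coprime_iff_not_dvd hp).2 ha) h'
    exact Nat.ModEq.eq_of_lt_of_lt this (by omega) (by omega)
  exact Finset.sum_nbij (fun b => a * b % p) hmaps hinj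
    (Finset.surjOn_of_injOn_of_card_le _ hmaps hinj le_rfl) (fun _ _ => rfl)

/-- a corollary comparing the two sharpenings of Voronoi's congruence. -/
theorem voronoi_corollary (p : ℕ) (hp : p.Prime) (hodd : Odd p)
    (i : ℕ) (hipos : 0 < i) (hieven : Even i) (hcop : Nat.Coprime i p)
    (h0 : ¬ i ≡ 0 [MOD p - 1]) (h2 : ¬ i ≡ 2 [MOD p - 1])
    (a : ℕ) (ha1 : 2 ≤ a) (ha2 : a ≤ p - 1) :
    ratCongr p 2 (2 * ((a : ℚ) ^ i - 1) * bernoulli i / i)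
      (∑ b ∈ Finset.Icc 1 (p - 1),
        (((a : ℚ) * b) ^ (i - 1) + ((a * b % p : ℕ) : ℚ) ^ (i - 1)) *
          ((a * b / p : ℕ) : ℚ)) := by
  haveI : Fact p.Prime := ⟨hp⟩
  have hi2 : 2 < i := by
    rcases hieven with ⟨k, rfl⟩
    by_contra h
    have : k = 1 := by omega
    subst this
    exact h2 rfl
  have hp7 : 7 ≤ p := by
    by_contra h
    have hlt : p < 7 := by omega
    rcases hieven with ⟨k, rfl⟩
    unfold Nat.ModEq at h0 h2
    interval_cases p <;> first | (revert hp; decide) | (revert hodd; decide) | omega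
  have h2' : ¬ (p - 1) ∣ i - 2 := fun hd =>
    h2 ((Nat.modEq_iff_dvd' (by omega)).2 hd).symm
  have hpa : ¬ p ∣ a := fun hd => by have := Nat.le_of_dvd (by omega) hd; omega
  have hpi : ¬ p ∣ i := (Nat.Prime.coprime_iff_not_dvd hp).1 hcop.symm
  obtain ⟨u, hu, hS⟩ := sum_eq hp7 hieven hi2 h2'
  obtain ⟨n, rfl⟩ : ∃ n, i = n + 2 := ⟨i - 2, by omega⟩
  have key : ∀ b : ℕ, ∃ c : ℤ, 2 * (((a : ℚ) * b) ^ (n + 2) - ((a * b % p : ℕ) : ℚ) ^ (n + 2))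
      - ((n + 2 : ℕ) : ℚ) * p * ((((a : ℚ) * b) ^ (n + 1) + ((a * b % p : ℕ) : ℚ) ^ (n + 1)) *
          ((a * b / p : ℕ) : ℚ)) = (p : ℚ) ^ 3 * c := by
    intro b
    obtain ⟨c, hc⟩ := trap ((a * b % p : ℕ) : ℤ) ((p : ℤ) * ((a * b / p : ℕ) : ℤ)) n
    refine ⟨((a * b / p : ℕ) : ℤ) ^ 3 * c, ?_⟩
    have hx : ((a * b % p : ℕ) : ℤ) + (p : ℤ) * ((a * b / p : ℕ) : ℤ) = (a : ℤ) * b := by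
      exact_mod_cast Nat.mod_add_div (a * b) p
    rw [hx] at hc
    have hc' := congrArg (Int.cast : ℤ → ℚ) hc
    generalize a * b % p = y at *
    generalize a * b / p = q at *
    push_cast at hc' ⊢
    linear_combination hc'
  choose c hc using key
  have hsum := Finset.sum_congr (rfl : Finset.Icc 1 (p - 1) = _) (fun b _ => hc b)
  rw [Finset.sum_sub_distrib, ← Finset.mul_sum, ← Finset.mul_sum, ← Finset.mul_sum,
    Finset.sum_sub_distrib, perm_sum hp hpa (fun y => (y : ℚ) ^ (n + 2))] at hsum
  simp only [mul_pow _ _ (n + 2)] at hsum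
  rw [← Finset.mul_sum, hS] at hsum
  refine ⟨(∑ b ∈ Finset.Icc 1 (p - 1), (c b : ℚ) - 2 * ((a : ℚ) ^ (n + 2) - 1) * u) *
    (1 / ((n + 2 : ℕ) : ℚ)), ?_, mem_vR.1 ?_⟩
  · rw [show n + 2 - 1 = n + 1 by omega]
    generalize ∑ b ∈ Finset.Icc 1 (p - 1), (((a : ℚ) * b) ^ (n + 1) +
      ((a * b % p : ℕ) : ℚ) ^ (n + 1)) * ((a * b / p : ℕ) : ℚ) = T at *
    have hp0 : (p : ℚ) ≠ 0 := by exact_mod_cast hp.ne_zero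
    have hn0 : ((n + 2 : ℕ) : ℚ) ≠ 0 := by positivity
    generalize ((n + 2 : ℕ) : ℚ) = N at *
    field_simp
    apply mul_left_cancel₀ hp0
    linear_combination hsum
  · refine mul_mem (sub_mem (sum_mem fun b _ => intCast_mem _ _) (mul_mem (mul_mem ?_ ?_) hu))
      (inv_mem_vR hpi)
    · exact_mod_cast nat_mem_vR (p := p) 2
    · exact sub_mem (pow_mem (nat_mem_vR _) _) (one_mem _)
end

section
/- Let p be an odd prime and let i be a positive integer with gcd(i,p) = 1, i ≢ 0 (mod p−1) and i ≢ 1 (mod p−1). Then the sum of the (i−1)-th powers of the odd integers below p satisfies 1^{i−1} + 3^{i−1} + 5^{i−1} + ⋯ + (p−2)^{i−1} ≡ (2^i − 1)·B_i/i (mod p). -/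
namespace OddPow

def pInt (p : ℕ) (x : ℚ) : Prop := ¬ (p ∣ x.den)

variable {p : ℕ}

lemma pInt_mul (hp : p.Prime) {x y : ℚ} (hx : pInt p x) (hy : pInt p y) : pInt p (x * y) := by
  intro h
  rcases hp.dvd_mul.1 (h.trans (Rat.mul_den_dvd x y)) with h | h
  · exact hx h
  · exact hy h

lemma pInt_add (hp : p.Prime) {x y : ℚ} (hx : pInt p x) (hy : pInt p y) : pInt p (x + y) := by
  intro h
  rcases hp.dvd_mul.1 (h.trans (Rat.add_den_dvd x y)) with h | h
  · exact hx h
  · exact hy h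

lemma pInt_int (hp : p.Prime) (z : ℤ) : pInt p (z : ℚ) := by
  intro h
  simp only [Rat.den_intCast] at h
  exact hp.one_lt.ne' (Nat.dvd_one.1 h)

lemma pInt_nat (hp : p.Prime) (z : ℕ) : pInt p (z : ℚ) := by
  simpa using pInt_int hp (z : ℤ)

lemma pInt_neg (hp : p.Prime) {x : ℚ} (hx : pInt p x) : pInt p (-x) := by
  simpa [pInt] using hx

lemma pInt_sub (hp : p.Prime) {x y : ℚ} (hx : pInt p x) (hy : pInt p y) : pInt p (x - y) := by
  rw [sub_eq_add_neg]; exact pInt_add hp hx (pInt_neg hp hy)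

lemma pInt_sum (hp : p.Prime) {f : ℕ → ℚ} (s : Finset ℕ) (h : ∀ i ∈ s, pInt p (f i)) :
    pInt p (∑ i ∈ s, f i) := by
  induction s using Finset.induction_on with
  | empty => simpa using pInt_nat hp 0
  | insert a s ha ih =>
    rw [Finset.sum_insert ha]
    exact pInt_add hp (h a (by simp)) (ih fun i hi => h i (by simp [hi]))

lemma pInt_inv (hp : p.Prime) {m : ℕ} (hm : ¬ p ∣ m) : pInt p ((m : ℚ)⁻¹) := by
  intro h
  have hm0 : m ≠ 0 := by rintro rfl; simp at hm
  rw [Rat.inv_natCast_den_of_pos (Nat.pos_of_ne_zero hm0)] at h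
  exact hm h

lemma pInt_pow_div (hp : p.Prime) (a b d : ℕ) (hb : 1 ≤ b) (hbd : b ≤ d) (hbp : b + 2 < p + 1)
    (ha : a = d - b) : pInt p ((p : ℚ) ^ a / ((d + 1 : ℕ) : ℚ)) := by
  obtain ⟨e, m, hm, he⟩ := Nat.exists_eq_pow_mul_and_not_dvd (Nat.succ_ne_zero d) p hp.ne_one
  have hm0 : m ≠ 0 := by rintro rfl; simp at hm
  have hle : p ^ e ≤ d + 1 := by
    rw [Nat.succ_eq_add_one] at he
    rw [he]; exact Nat.le_mul_of_pos_right _ (Nat.pos_of_ne_zero hm0)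
  have hea : e ≤ a := by
    by_contra hcon
    have h1 : 1 ≤ e := by omega
    have h2 : p ^ e ≤ e + b := by omega
    have h3 : e + b + 1 ≤ p ^ e := by
      clear hle he hcon h2
      induction e, h1 using Nat.le_induction with
      | base => simp; omega
      | succ e h1 ih =>
        rw [pow_succ]
        have : 2 ≤ p := hp.two_le
        nlinarith
    omega
  have hp0 : (p : ℚ) ≠ 0 := by exact_mod_cast hp.ne_zero
  have hm0' : (m : ℚ) ≠ 0 := by exact_mod_cast hm0
  have : (p : ℚ) ^ a / ((d + 1 : ℕ) : ℚ) = ((p ^ (a - e) : ℕ) : ℚ) * (m : ℚ)⁻¹ := by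
    rw [Nat.succ_eq_add_one] at he
    rw [he]
    obtain ⟨c, rfl⟩ := Nat.exists_eq_add_of_le hea
    push_cast
    rw [Nat.add_sub_cancel_left, pow_add]
    field_simp
  rw [this]
  exact pInt_mul hp (pInt_nat hp _) (pInt_inv hp hm)

lemma faul (p n : ℕ) : (∑ k ∈ Finset.range p, (k : ℚ) ^ n) =
    ∑ i ∈ Finset.range n, (n.choose i : ℚ) * ((p : ℚ) ^ (n - i + 1) / ((n - i + 1 : ℕ) : ℚ))
      * bernoulli i + p * bernoulli n := by
  rw [sum_range_pow, Finset.sum_range_succ]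
  congr 1
  · refine Finset.sum_congr rfl fun i hi => ?_
    have hi := Finset.mem_range.1 hi
    have h := Nat.choose_mul_succ_eq n i
    have h' : (n.choose i : ℚ) * (n + 1) = ((n + 1).choose i : ℚ) * ((n - i + 1 : ℕ) : ℚ) := by
      rw [show n - i + 1 = n + 1 - i by omega]
      exact_mod_cast h
    have hx : ((n - i + 1 : ℕ) : ℚ) ≠ 0 := by positivity
    have hy : (n + 1 : ℚ) ≠ 0 := by positivity
    rw [show n + 1 - i = n - i + 1 by omega]
    rw [mul_div_assoc', div_mul_eq_mul_div, div_eq_div_iff hy hx]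
    linear_combination (-(p : ℚ) ^ (n - i + 1) * bernoulli i) * h'
  · have hy : (n + 1 : ℚ) ≠ 0 := by positivity
    simp
    field_simp

lemma lemA (hp : p.Prime) (h3 : 3 ≤ p) (n : ℕ) (hB : ∀ i < n, pInt p (p * bernoulli i)) :
    ∃ t, pInt p t ∧ (∑ k ∈ Finset.range p, (k : ℚ) ^ n) = p * bernoulli n + p * t := by
  refine ⟨∑ i ∈ Finset.range n, (n.choose i : ℚ) * ((p : ℚ) ^ (n - i - 1) / ((n - i + 1 : ℕ) : ℚ))
      * (p * bernoulli i), ?_, ?_⟩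
  · refine pInt_sum hp _ fun i hi => ?_
    have hi := Finset.mem_range.1 hi
    exact pInt_mul hp (pInt_mul hp (pInt_nat hp _)
      (pInt_pow_div hp _ 1 _ le_rfl (by omega) (by omega) (by omega))) (hB i hi)
  · rw [faul, add_comm, Finset.mul_sum]
    congr 1
    refine Finset.sum_congr rfl fun i hi => ?_
    have hi := Finset.mem_range.1 hi
    rw [show n - i + 1 = (n - i - 1) + 2 by omega]
    ring

lemma pB (hp : p.Prime) (h3 : 3 ≤ p) (n : ℕ) : pInt p (p * bernoulli n) := by
  induction n using Nat.strong_induction_on with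
  | _ n ih =>
    obtain ⟨t, ht, h⟩ := lemA hp h3 n ih
    rw [eq_sub_of_add_eq h.symm]
    refine pInt_sub hp ?_ (pInt_mul hp (pInt_nat hp _) ht)
    exact pInt_sum hp _ fun i _ => by exact_mod_cast pInt_nat hp (i ^ n)

lemma S_zero (hp : p.Prime) (n : ℕ) (hn : ¬ (p - 1) ∣ n) :
    p ∣ ∑ k ∈ Finset.range p, k ^ n := by
  haveI : Fact p.Prime := ⟨hp⟩
  have hn0 : n ≠ 0 := by rintro rfl; simp at hn
  rw [← ZMod.natCast_eq_zero_iff]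
  push_cast
  have h1 : ∑ k ∈ Finset.range p, (k : ZMod p) ^ n = ∑ x : ZMod p, x ^ n := by
    refine Finset.sum_bij' (fun k _ => (k : ZMod p)) (fun x _ => x.val) ?_ ?_ ?_ ?_ ?_
    · simp
    · intro a _; simp [ZMod.val_lt]
    · intro a ha; exact ZMod.val_cast_of_lt (Finset.mem_range.1 ha)
    · simp
    · simp
  rw [h1]
  have h2 := FiniteField.sum_pow_units (ZMod p) n
  rw [ZMod.card, if_neg hn] at h2
  rw [← h2, Fintype.sum_eq_add_sum_compl (0 : ZMod p), zero_pow hn0, zero_add]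
  symm
  refine Finset.sum_bij' (fun u _ => (u : ZMod p))
    (fun x hx => Units.mk0 x (by simpa using hx)) ?_ ?_ ?_ ?_ ?_ <;> simp

lemma B_int (hp : p.Prime) (h3 : 3 ≤ p) (n : ℕ) (hn : ¬ (p - 1) ∣ n) : pInt p (bernoulli n) := by
  obtain ⟨t, ht, h⟩ := lemA hp h3 n fun i _ => pB hp h3 i
  obtain ⟨s, hs⟩ := S_zero hp n hn
  have hs' : (∑ k ∈ Finset.range p, (k : ℚ) ^ n) = p * s := by exact_mod_cast hs
  have hp0 : (p : ℚ) ≠ 0 := by exact_mod_cast hp.ne_zero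
  have : bernoulli n = s - t := by
    apply mul_left_cancel₀ hp0
    linear_combination hs' - h
  rw [this]
  exact pInt_sub hp (pInt_nat hp _) ht

lemma lemB (hp : p.Prime) (h5 : 5 ≤ p) (i : ℕ) (hi : 1 ≤ i) (hn : ¬ (p - 1) ∣ (i - 1)) :
    ∃ t, pInt p t ∧ (∑ k ∈ Finset.range p, (k : ℚ) ^ i) = p * bernoulli i + p ^ 2 * t := by
  obtain ⟨n, rfl⟩ := Nat.exists_eq_add_of_le' hi
  simp only [Nat.add_sub_cancel] at hn
  refine ⟨∑ i ∈ Finset.range n, ((n + 1).choose i : ℚ) *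
      ((p : ℚ) ^ (n + 1 - i - 2) / ((n + 1 - i + 1 : ℕ) : ℚ)) * (p * bernoulli i) +
      ((n + 1 : ℕ) : ℚ) * ((2 : ℕ) : ℚ)⁻¹ * bernoulli n, ?_, ?_⟩
  · refine pInt_add hp (pInt_sum hp _ fun i hi => ?_) ?_
    · have hi := Finset.mem_range.1 hi
      exact pInt_mul hp (pInt_mul hp (pInt_nat hp _)
        (pInt_pow_div hp _ 2 _ (by omega) (by omega) (by omega) (by omega)))
        (pB hp (by omega) i)
    · refine pInt_mul hp (pInt_mul hp (pInt_nat hp _) (pInt_inv hp fun h => ?_))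
        (B_int hp (by omega) n hn)
      have := Nat.le_of_dvd (by norm_num) h
      omega
  · rw [faul, add_comm, Finset.sum_range_succ, mul_add, Finset.mul_sum]
    congr 2
    · refine Finset.sum_congr rfl fun i hi => ?_
      have hi := Finset.mem_range.1 hi
      rw [show n + 1 - i + 1 = (n + 1 - i - 2) + 3 by omega]
      ring
    · simp
      ring

lemma split_even (i m : ℕ) : ∑ k ∈ Finset.range (2 * m + 1), (k : ℤ) ^ i =
    ∑ k ∈ Finset.range (m + 1), (2 * k : ℤ) ^ i + ∑ k ∈ Finset.range m, (2 * k + 1 : ℤ) ^ i := by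
  induction m with
  | zero => simp
  | succ m ih =>
    rw [show 2 * (m + 1) + 1 = 2 * m + 1 + 1 + 1 by ring, Finset.sum_range_succ,
      Finset.sum_range_succ, ih, Finset.sum_range_succ _ (m + 1),
      Finset.sum_range_succ (fun k : ℕ => (2 * k + 1 : ℤ) ^ i) m]
    push_cast
    ring

lemma key (i m : ℕ) : ∃ z : ℤ,
    (2 ^ i - 1) * ∑ k ∈ Finset.range (2 * m + 1), (k : ℤ) ^ i =
      i * (2 * m + 1) * ∑ k ∈ Finset.range m, (2 * k + 1 : ℤ) ^ (i - 1) + (2 * m + 1) ^ 2 * z := by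
  refine ⟨∑ k ∈ Finset.range m,
    (Polynomial.powAddExpansion (2 * k + 1 : ℤ) (2 * m + 1) i).1, ?_⟩
  have h1 : 2 ^ i * ∑ k ∈ Finset.range (2 * m + 1), (k : ℤ) ^ i =
      ∑ k ∈ Finset.range (m + 1), (2 * k : ℤ) ^ i +
      ∑ k ∈ Finset.range m, ((2 * k + 1 : ℤ) + (2 * m + 1)) ^ i := by
    rw [show 2 * m + 1 = (m + 1) + m by ring, Finset.sum_range_add, mul_add, Finset.mul_sum,
      Finset.mul_sum]
    congr 1
    · exact Finset.sum_congr rfl fun k _ => by rw [mul_pow]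
    · refine Finset.sum_congr rfl fun k _ => ?_
      rw [← mul_pow]
      push_cast
      ring
  have h2 : ∑ k ∈ Finset.range m, ((2 * k + 1 : ℤ) + (2 * m + 1)) ^ i =
      ∑ k ∈ Finset.range m, (2 * k + 1 : ℤ) ^ i +
      i * (2 * m + 1) * ∑ k ∈ Finset.range m, (2 * k + 1 : ℤ) ^ (i - 1) +
      (2 * m + 1) ^ 2 * ∑ k ∈ Finset.range m,
        (Polynomial.powAddExpansion (2 * k + 1 : ℤ) (2 * m + 1) i).1 := by
    rw [Finset.mul_sum, Finset.mul_sum, ← Finset.sum_add_distrib, ← Finset.sum_add_distrib]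
    refine Finset.sum_congr rfl fun k _ => ?_
    refine (Polynomial.powAddExpansion (2 * k + 1 : ℤ) (2 * m + 1) i).2.trans ?_
    ring
  rw [sub_mul, h1, h2, one_mul, split_even]
  ring

end OddPow

/-- `1^{i-1} + 3^{i-1} + ⋯ + (p-2)^{i-1} ≡ (2^i - 1)·B_i/i (mod p)`. -/
theorem odd_powers_sum (p : ℕ) (hp : p.Prime) (hodd : Odd p)
    (i : ℕ) (hipos : 0 < i) (hcop : Nat.Coprime i p)
    (h0 : ¬ i ≡ 0 [MOD p - 1]) (h1 : ¬ i ≡ 1 [MOD p - 1]) :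
    ratCongr p 1 (∑ k ∈ Finset.range ((p - 1) / 2), ((2 * k + 1 : ℕ) : ℚ) ^ (i - 1))
      ((2 ^ i - 1) * bernoulli i / i) := by
  have hn : ¬ (p - 1) ∣ (i - 1) := fun h =>
    h1 ((Nat.modEq_iff_dvd' hipos).2 h).symm
  have h5 : 5 ≤ p := by
    have h2 := hp.two_le
    by_contra hlt
    have h4 : p = 3 := by
      obtain ⟨c, hc⟩ := hodd
      omega
    subst h4
    simp only [Nat.ModEq] at h0 h1
    omega
  obtain ⟨u, hu, hS⟩ := OddPow.lemB hp h5 i hipos hn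
  obtain ⟨m, rfl⟩ := hodd
  obtain ⟨z, hz⟩ := OddPow.key i m
  have hz' : ((2 : ℚ) ^ i - 1) * ∑ k ∈ Finset.range (2 * m + 1), (k : ℚ) ^ i =
      i * (2 * m + 1) * ∑ k ∈ Finset.range m, (2 * k + 1 : ℚ) ^ (i - 1) + (2 * m + 1) ^ 2 * z := by
    exact_mod_cast hz
  have hi0 : (i : ℚ) ≠ 0 := by positivity
  have hp0 : (2 * m + 1 : ℚ) ≠ 0 := by positivity
  refine ⟨(((2 ^ i - 1 : ℤ) : ℚ) * u - z) * (i : ℚ)⁻¹, ?_, ?_⟩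
  · rw [show (2 * m + 1 - 1) / 2 = m by omega]
    rw [hS] at hz'
    push_cast at hz' ⊢
    field_simp
    apply mul_left_cancel₀ hp0
    linear_combination -hz'
  · refine OddPow.pInt_mul hp (OddPow.pInt_sub hp (OddPow.pInt_mul hp (OddPow.pInt_int hp _) hu)
      (OddPow.pInt_int hp _)) (OddPow.pInt_inv hp fun h => ?_)
    have := Nat.eq_one_of_dvd_coprimes hcop h dvd_rfl
    omega
end

section
/- Let p be an odd prime and let i be a positive odd integer with gcd(i,p) = 1, i ≢ 1 (mod p−1) and i ≢ 2 (mod p−1). Then Lehmer's congruence holds: Σ_{r=1}^{(p−1)/2} r^{i−1} ≡ (2^{2−i} − 1)·B_{i−1}·p/2 (mod p²), where 2^{2−i} = 1/2^{i−2} is a rational number. -/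
open Polynomial in
theorem lc_iter (N j : ℕ) : (derivative^[j]) (Polynomial.bernoulli N) =
    (N.descFactorial j : ℚ[X]) * Polynomial.bernoulli (N - j) := by
  induction j with
  | zero => simp
  | succ j ih =>
    rw [Function.iterate_succ_apply', ih, derivative_mul, derivative_natCast,
      derivative_bernoulli, Nat.descFactorial_succ, Nat.sub_sub]
    push_cast
    ring

open Polynomial in
theorem lc_hasse (N j : ℕ) : hasseDeriv j (Polynomial.bernoulli N) =
    (N.choose j : ℚ[X]) * Polynomial.bernoulli (N - j) := by
  have h := congrFun (Polynomial.factorial_smul_hasseDeriv (R := ℚ) j) (Polynomial.bernoulli N)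
  rw [lc_iter, Nat.descFactorial_eq_factorial_mul_choose] at h
  have hf : ((j.factorial : ℕ) : ℚ[X]) ≠ 0 := by exact_mod_cast j.factorial_ne_zero
  apply mul_left_cancel₀ hf
  simpa [nsmul_eq_mul, mul_assoc] using h

open Polynomial in
theorem lc_taylor (N : ℕ) (x y : ℚ) : (Polynomial.bernoulli N).eval (y + x) =
    ∑ j ∈ Finset.range (N + 1), (N.choose j : ℚ) * (Polynomial.bernoulli (N - j)).eval x * y ^ j := by
  rw [← Polynomial.taylor_eval, Polynomial.eval_eq_sum_range' (n := N + 1)]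
  · refine Finset.sum_congr rfl fun j _ => ?_
    rw [taylor_coeff, lc_hasse]
    simp
  · rw [natDegree_taylor, Nat.lt_succ_iff, natDegree_le_iff_coeff_eq_zero]
    intro m hm
    rw [coeff_bernoulli, if_neg (by omega)]

theorem lc_half (k : ℕ) : (Polynomial.bernoulli k).eval (1 / 2 : ℚ) =
    (2 / 2 ^ k - 1) * bernoulli k := by
  have h := bernoulliFun_eval_half k
  have e : bernoulliFun k 2⁻¹ = (((Polynomial.bernoulli k).eval (1 / 2 : ℚ) : ℚ) : ℝ) := by
    rw [bernoulliFun, Polynomial.eval_map, Polynomial.eval₂_eq_eval_map]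
    have := Polynomial.eval_map_apply (algebraMap ℚ ℝ) (p := Polynomial.bernoulli k) (1 / 2 : ℚ)
    simpa using this
  rw [e] at h
  apply Rat.cast_injective (α := ℝ)
  rw [h]
  push_cast
  rfl

theorem lc_mem {p : ℕ} [Fact p.Prime] {x : ℚ} :
    x ∈ (Rat.padicValuation p).integer ↔ ¬ p ∣ x.den := by
  rw [Valuation.mem_integer_iff, Rat.padicValuation_le_one_iff]

theorem lc_inv {p : ℕ} [hp : Fact p.Prime] {m : ℕ} (h : Nat.Coprime m p) :
    (1 / m : ℚ) ∈ (Rat.padicValuation p).integer := by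
  rw [lc_mem]
  intro hd
  have h0 : m ≠ 0 := by
    rintro rfl
    exact hp.out.one_lt.ne' (by simpa using h)
  have : (1 / m : ℚ).den ∣ m := by
    simp [h0]
  have := Nat.dvd_gcd (hd.trans this) dvd_rfl
  rw [h] at this
  exact hp.out.one_lt.ne' (Nat.dvd_one.mp this)

theorem lc_pB {p : ℕ} [hp : Fact p.Prime] (hodd : Odd p) (m : ℕ) :
    (p : ℚ) * bernoulli m ∈ (Rat.padicValuation p).integer := by
  have hpA : (p : ℚ) ∈ (Rat.padicValuation p).integer := natCast_mem _ p
  rcases m.even_or_odd' with ⟨k, rfl | rfl⟩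
  · obtain ⟨z, hz⟩ := Bernoulli.vonStaudt_clausen k
    replace hz := eq_sub_iff_add_eq.2 hz.symm
    rw [hz, mul_sub, Finset.mul_sum]
    refine sub_mem (mul_mem hpA (intCast_mem _ z)) (sum_mem fun q hq => ?_)
    simp only [Finset.mem_filter] at hq
    by_cases hqp : q = p
    · subst hqp
      have : (q : ℚ) ≠ 0 := by exact_mod_cast hp.out.ne_zero
      rw [mul_one_div_cancel this]
      exact one_mem _
    · refine mul_mem hpA (lc_inv ?_)
      exact (Nat.coprime_primes (by tauto) hp.out).2 hqp
  · rcases Nat.eq_zero_or_pos k with rfl | hk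
    · have h2 := lc_inv (p := p) (m := 2) ((Nat.coprime_two_left).2 hodd)
      have : (p : ℚ) * bernoulli (2 * 0 + 1) = - (p * (1 / (2 : ℕ))) := by
        simp [bernoulli_one]; ring
      rw [this]
      exact neg_mem (mul_mem hpA h2)
    · rw [bernoulli_eq_zero_of_odd ⟨k, rfl⟩ (by omega), mul_zero]
      exact zero_mem _

/-- Lehmer's congruence `(I)_i` modulo `p²`. -/
theorem lehmer_congruence (p : ℕ) (hp : p.Prime) (hodd : Odd p)
    (i : ℕ) (hipos : 0 < i) (hiodd : Odd i) (hcop : Nat.Coprime i p)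
    (h1 : ¬ i ≡ 1 [MOD p - 1]) (h2 : ¬ i ≡ 2 [MOD p - 1]) :
    ratCongr p 2 (∑ r ∈ Finset.Icc 1 ((p - 1) / 2), (r : ℚ) ^ (i - 1))
      ((1 / 2 ^ (i - 2) - 1) * bernoulli (i - 1) * (p : ℚ) / 2) := by
  haveI : Fact p.Prime := ⟨hp⟩
  have hi1 : i ≠ 1 := fun h => h1 (h ▸ rfl)
  obtain ⟨k, rfl⟩ : ∃ k, i = 2 * k + 3 := by
    obtain ⟨k, hk⟩ := hiodd
    exact ⟨k - 1, by omega⟩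
  obtain ⟨q, rfl⟩ := id hodd
  set p := 2 * q + 1 with hpdef
  have e1 : (p - 1) / 2 = q := by omega
  rw [e1]
  have hS : ∑ r ∈ Finset.Icc 1 q, (r : ℚ) ^ (2 * k + 3 - 1)
      = ∑ r ∈ Finset.range (q + 1), (r : ℚ) ^ (2 * k + 2) := by
    rw [Finset.range_eq_Ico, Finset.sum_eq_sum_Ico_succ_bot (by omega)]
    have : Finset.Icc 1 q = Finset.Ico (0 + 1) (q + 1) := by
      ext a; simp only [Finset.mem_Icc, Finset.mem_Ico]; omega
    rw [this]
    simp
  have hF := Polynomial.sum_range_pow_eq_bernoulli_sub (q + 1) (2 * k + 2)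
  have hz : bernoulli (2 * k + 3) = 0 := bernoulli_eq_zero_of_odd ⟨k + 1, by ring⟩ (by omega)
  have hx : ((q + 1 : ℕ) : ℚ) = (p : ℚ) / 2 + 1 / 2 := by
    rw [hpdef]; push_cast; ring
  have hI : ((2 * k + 3 : ℕ) : ℚ) ≠ 0 := by positivity
  have ho : (Polynomial.bernoulli (2 * k + 1)).eval (1 / 2 : ℚ) = 0 := by
    rw [lc_half]
    rcases Nat.eq_zero_or_pos k with rfl | hk
    · norm_num
    · rw [bernoulli_eq_zero_of_odd ⟨k, rfl⟩ (by omega), mul_zero]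
  have ho3 : (Polynomial.bernoulli (2 * k + 3)).eval (1 / 2 : ℚ) = 0 := by
    rw [lc_half, hz, mul_zero]
  set U : ℚ := ∑ j ∈ Finset.range (2 * k + 1), ((2 * k + 3).choose (j + 3) : ℚ) *
    ((2 * (1 / (2 : ℕ)) ^ (2 * k - j) - 1) * (p * bernoulli (2 * k - j))) *
      ((p : ℚ) ^ j * (1 / (2 : ℕ)) ^ (j + 3)) with hU
  have hT : (Polynomial.bernoulli (2 * k + 3)).eval ((p : ℚ) / 2 + 1 / 2) =
      ((2 * k + 3 : ℕ) : ℚ) * ((1 / 2 ^ (2 * k + 1) - 1) * bernoulli (2 * k + 2) * (p : ℚ) / 2)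
      + (p : ℚ) ^ 2 * U := by
    rw [lc_taylor, Finset.sum_range_succ', Finset.sum_range_succ', Finset.sum_range_succ']
    have e2 : 2 * k + 3 - (0 + 1 + 1) = 2 * k + 1 := by omega
    have e3 : 2 * k + 3 - (0 + 1) = 2 * k + 2 := by omega
    rw [e2, e3, ho, Nat.sub_zero, ho3, lc_half]
    have : ∑ j ∈ Finset.range (2 * k + 1), ((2 * k + 3).choose (j + 1 + 1 + 1) : ℚ) *
        (Polynomial.bernoulli (2 * k + 3 - (j + 1 + 1 + 1))).eval (1 / 2 : ℚ) *
          ((p : ℚ) / 2) ^ (j + 1 + 1 + 1) = (p : ℚ) ^ 2 * U := by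
      rw [hU, Finset.mul_sum]
      refine Finset.sum_congr rfl fun j _ => ?_
      have e4 : 2 * k + 3 - (j + 1 + 1 + 1) = 2 * k - j := by omega
      rw [lc_half, e4, div_pow]
      push_cast
      rw [one_div_pow, one_div_pow]
      ring
    rw [this]
    have e5 : (2 : ℚ) / 2 ^ (2 * k + 2) = 1 / 2 ^ (2 * k + 1) := by
      rw [div_eq_div_iff (by positivity) (by positivity)]; ring
    rw [e5]
    simp
    ring
  refine ⟨1 / ((2 * k + 3 : ℕ) : ℚ) * U, ?_, ?_⟩
  · have hF' : ((2 * k + 3 : ℕ) : ℚ) * ∑ r ∈ Finset.range (q + 1), (r : ℚ) ^ (2 * k + 2) =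
        (Polynomial.bernoulli (2 * k + 3)).eval ((p : ℚ) / 2 + 1 / 2) := by
      rw [← hx, ← sub_zero (Polynomial.eval _ _), ← hz]
      rw [← hF]
      push_cast
      ring
    rw [hT] at hF'
    rw [hS]
    have e6 : 2 * k + 3 - 2 = 2 * k + 1 := by omega
    have e7 : 2 * k + 3 - 1 = 2 * k + 2 := by omega
    rw [e6, e7]
    apply mul_left_cancel₀ hI
    rw [mul_sub, hF']
    field_simp
    ring
  · rw [← lc_mem]
    have h2A := lc_inv (p := p) (m := 2) ((Nat.coprime_two_left).2 hodd)
    refine mul_mem (lc_inv hcop) (sum_mem fun j _ => ?_)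
    refine mul_mem (mul_mem (natCast_mem _ _) (mul_mem (sub_mem (mul_mem ?_ (pow_mem h2A _))
      (one_mem _)) (lc_pB hodd _))) (mul_mem (pow_mem (natCast_mem _ _) _) (pow_mem h2A _))
    exact_mod_cast natCast_mem (Rat.padicValuation p).integer 2
end

section
/- Let p be an odd prime and let i be a positive odd integer with i ≢ 0, 1, 2 (mod p), i ≢ 1 (mod p−1) and i ≢ 3 (mod p−1). Then the sum S = Σ_{k=1}^{(p−1)/2} (p−2k)^{i−1} is divisible by p, and B_{i−1}·(2^i − 1) ≡ 2·S/p − (i−1)·2^{i−2}·Σ_{k=1}^{(p−1)/2} k^{i−2} (mod p²). -/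
open Finset in
theorem aux_pair (m : ℕ) (f : ℕ → ℤ) :
    ∑ j ∈ Ico 1 (2 * m + 1), f j
      = ∑ k ∈ Icc 1 m, f k + ∑ k ∈ Icc 1 m, f (2 * m + 1 - k) := by
  rw [← Finset.sum_Ico_consecutive f (by omega : 1 ≤ m + 1) (by omega : m + 1 ≤ 2 * m + 1)]
  congr 1
  apply Finset.sum_nbij' (fun k => 2 * m + 1 - k) (fun k => 2 * m + 1 - k)
  · intro a ha; simp only [mem_Ico, mem_Icc] at *; omega
  · intro a ha; simp only [mem_Ico, mem_Icc] at *; omega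
  · intro a ha; simp only [mem_Ico, mem_Icc] at *; omega
  · intro a ha; simp only [mem_Ico, mem_Icc] at *; omega
  · intro a ha; simp only [mem_Ico, mem_Icc] at *; congr 1; omega

open Finset in
theorem aux_parity (m : ℕ) (f : ℕ → ℤ) :
    ∑ j ∈ Ico 1 (2 * m + 1), f j
      = ∑ k ∈ Icc 1 m, f (2 * k) + ∑ k ∈ Icc 1 m, f (2 * m + 1 - 2 * k) := by
  have h1 : ∑ k ∈ Icc 1 m, f (2 * m + 1 - 2 * k) = ∑ k ∈ Icc 1 m, f (2 * k - 1) := by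
    apply Finset.sum_nbij' (fun k => m + 1 - k) (fun k => m + 1 - k)
    · intro a ha; simp only [mem_Icc] at *; omega
    · intro a ha; simp only [mem_Icc] at *; omega
    · intro a ha; simp only [mem_Icc] at *; omega
    · intro a ha; simp only [mem_Icc] at *; omega
    · intro a ha; simp only [mem_Icc] at *; congr 1; omega
  rw [h1]
  clear h1
  induction m with
  | zero => simp
  | succ m ih =>
    rw [Finset.sum_Icc_succ_top (by omega), Finset.sum_Icc_succ_top (by omega),
      show 2 * (m + 1) + 1 = (2 * m + 1) + 1 + 1 by ring,
      Finset.sum_Ico_succ_top (by omega), Finset.sum_Ico_succ_top (by omega), ih,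
      show 2 * (m + 1) - 1 = 2 * m + 1 by omega, show 2 * m + 1 + 1 = 2 * (m + 1) by ring]
    ring

theorem aux_expand (n : ℕ) (x y : ℤ) : ∃ c : ℤ, (y + x) ^ (n + 2) =
    x ^ (n + 2) + (n + 2) * y * x ^ (n + 1) + ((n + 2).choose 2 : ℕ) * y ^ 2 * x ^ n
      + y ^ 3 * c := by
  induction n with
  | zero => exact ⟨0, by simp; ring⟩
  | succ n ih =>
    obtain ⟨c, hc⟩ := ih
    refine ⟨c * (y + x) + ((n + 2).choose 2 : ℕ) * x ^ n, ?_⟩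
    rw [pow_succ, hc, show n + 1 + 2 = (n + 2) + 1 by ring, Nat.choose_succ_succ' (n + 2) 1]
    push_cast
    simp only [Nat.choose_one_right]
    push_cast
    ring

/-- expansion of `∑ (p - a k)^n` modulo `p^3`, `n = m + 2` even. -/
theorem aux_sum_expand (s : Finset ℕ) (n : ℕ) (hn : Even n) (a p : ℤ) : ∃ c : ℤ,
    ∑ k ∈ s, (p - a * k) ^ (n + 2) = a ^ (n + 2) * ∑ k ∈ s, (k : ℤ) ^ (n + 2)
      - (n + 2) * p * a ^ (n + 1) * ∑ k ∈ s, (k : ℤ) ^ (n + 1)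
      + ((n + 2).choose 2 : ℕ) * p ^ 2 * a ^ n * ∑ k ∈ s, (k : ℤ) ^ n + p ^ 3 * c := by
  choose c hc using fun k : ℕ => aux_expand n (-(a * k)) p
  refine ⟨∑ k ∈ s, c k, ?_⟩
  simp only [Finset.mul_sum, ← Finset.sum_sub_distrib, ← Finset.sum_add_distrib]
  refine Finset.sum_congr rfl fun k _ => ?_
  rw [sub_eq_add_neg, hc k, (show Even (n + 2) by exact hn.add even_two).neg_pow, hn.neg_pow,
    (show Odd (n + 1) from hn.add_one).neg_pow]
  ring

theorem aux_pow_sum {p : ℕ} (l : ℕ) [Fact p.Prime] (hl : ¬ (p - 1) ∣ l) :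
    (p : ℤ) ∣ ∑ v ∈ Finset.Ico 1 p, (v : ℤ) ^ l := by
  rw [← ZMod.intCast_zmod_eq_zero_iff_dvd]
  push_cast
  have hbij : (∑ v ∈ Finset.Ico 1 p, (v : ZMod p) ^ l) = ∑ u : (ZMod p)ˣ, (u : ZMod p) ^ l :=
    Finset.sum_bij'
      (fun v hv ↦ Units.mk0 (v : ZMod p) (mt (ZMod.natCast_eq_zero_iff v p).mp (by
        grind [Nat.not_dvd_of_pos_of_lt])))
      (fun u _ ↦ (u : ZMod p).val)
      (fun _ _ ↦ Finset.mem_univ _)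
      (fun u _ ↦ by grind [u.ne_zero, ZMod.val_ne_zero, ZMod.val_lt])
      (fun v hv ↦ by simp [ZMod.val_cast_of_lt (Finset.mem_Ico.mp hv).2])
      (fun u _ ↦ Units.ext (ZMod.natCast_zmod_val _))
      (fun _ _ ↦ rfl)
  rw [hbij, FiniteField.sum_pow_units, ZMod.card, if_neg hl]

noncomputable def auxR (p : ℕ) [Fact p.Prime] : Subring ℚ := (Rat.padicValuation p).integer

theorem auxR_iff {p : ℕ} [Fact p.Prime] {x : ℚ} : x ∈ auxR p ↔ ¬ p ∣ x.den :=
  Rat.padicValuation_le_one_iff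

theorem auxR_inv {p : ℕ} [Fact p.Prime] {q : ℕ} (h : ¬ p ∣ q) : (1 : ℚ) / q ∈ auxR p := by
  rw [auxR_iff]
  have hq : q ≠ 0 := by rintro rfl; exact h (dvd_zero _)
  simpa [Rat.inv_natCast_den, hq] using h

theorem aux_bern {p : ℕ} [hp : Fact p.Prime] (j : ℕ) (hj : Even j) (hj' : ¬ (p - 1) ∣ j) :
    bernoulli j ∈ auxR p := by
  obtain ⟨k, rfl⟩ := even_iff_exists_two_mul.mp hj
  obtain ⟨z, hz⟩ := Bernoulli.vonStaudt_clausen k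
  rw [← sub_eq_iff_eq_add] at hz
  rw [← hz]
  refine sub_mem (intCast_mem _ _) (sum_mem fun q hq => auxR_inv fun hd => ?_)
  simp only [Finset.mem_filter] at hq
  rw [Nat.prime_dvd_prime_iff_eq hp.out hq.2.1] at hd
  subst hd
  exact hj' hq.2.2

theorem aux_bern_mul {p : ℕ} [hp : Fact p.Prime] (hp2 : p ≠ 2) (j : ℕ) :
    (p : ℚ) * bernoulli j ∈ auxR p := by
  rcases Nat.even_or_odd j with hj | hj
  · obtain ⟨k, rfl⟩ := even_iff_exists_two_mul.mp hj
    obtain ⟨z, hz⟩ := Bernoulli.vonStaudt_clausen k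
    rw [← sub_eq_iff_eq_add] at hz
    rw [← hz, mul_sub, Finset.mul_sum]
    refine sub_mem (mul_mem (natCast_mem _ _) (intCast_mem _ _)) (sum_mem fun q hq => ?_)
    simp only [Finset.mem_filter] at hq
    by_cases hd : p ∣ q
    · rw [Nat.prime_dvd_prime_iff_eq hp.out hq.2.1] at hd
      subst hd
      rw [mul_one_div_cancel (by exact_mod_cast hp.out.ne_zero)]
      exact one_mem _
    · exact mul_mem (natCast_mem _ _) (auxR_inv hd)
  · rcases eq_or_ne j 1 with rfl | h1
    · refine mul_mem (natCast_mem _ _) ?_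
      rw [bernoulli_one, neg_div]
      refine neg_mem ?_
      have := auxR_inv (p := p) (q := 2) (by
        rw [Nat.prime_dvd_prime_iff_eq hp.out Nat.prime_two]; exact hp2)
      exact_mod_cast this
    · rw [bernoulli_eq_zero_of_odd hj (by have := hj.pos; omega), mul_zero]
      exact zero_mem _

theorem aux_faulhaber {p : ℕ} [hp : Fact p.Prime] (hp2 : p ≠ 2) (n : ℕ) (hn : Even n)
    (hn0 : 2 ≤ n) (hd : ¬ (p - 1) ∣ n) (h1 : ¬ p ∣ n + 3) :
    ∃ a ∈ auxR p, ∑ k ∈ Finset.Ico 1 p, (k : ℚ) ^ (n + 2)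
      = p * bernoulli (n + 2) + p ^ 3 * a := by
  have hinv : (1 : ℚ) / ((n + 3 : ℕ) : ℚ) ∈ auxR p := auxR_inv h1
  have hp0 : (p : ℚ) ≠ 0 := by exact_mod_cast hp.out.ne_zero
  have hF := sum_range_pow p (n + 2)
  have hL : ∑ k ∈ Finset.range p, (k : ℚ) ^ (n + 2) = ∑ k ∈ Finset.Ico 1 p, (k : ℚ) ^ (n + 2) := by
    rw [Finset.range_eq_Ico, Finset.sum_eq_sum_Ico_succ_bot hp.out.pos]
    simp
  rw [hL, Finset.sum_range_succ, Finset.sum_range_succ, Finset.sum_range_succ,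
    bernoulli_eq_zero_of_odd (n := n + 1) hn.add_one (by omega)] at hF
  have hne : ((n : ℚ) + 3) ≠ 0 := by positivity
  have hc : (n + 2 + 1).choose (n + 2) = n + 3 := by simp
  rw [hc, show n + 2 + 1 - (n + 2) = 1 by omega, show n + 2 + 1 - n = 3 by omega] at hF
  refine ⟨(∑ j ∈ Finset.range n, (p * bernoulli j) * ((n + 2 + 1).choose j : ℕ) *
      (p : ℚ) ^ (n - 1 - j) * (1 / ((n + 3 : ℕ) : ℚ)))
      + bernoulli n * ((n + 2 + 1).choose n : ℕ) * (1 / ((n + 3 : ℕ) : ℚ)), ?_, ?_⟩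
  · refine add_mem (sum_mem fun j _ => ?_) ?_
    · exact mul_mem (mul_mem (mul_mem (aux_bern_mul hp2 j) (natCast_mem _ _))
        (pow_mem (natCast_mem _ _) _)) hinv
    · exact mul_mem (mul_mem (aux_bern n hn hd) (natCast_mem _ _)) hinv
  · rw [hF, mul_add, Finset.mul_sum]
    have : ∀ j ∈ Finset.range n, bernoulli j * ((n + 2 + 1).choose j : ℕ) * (p : ℚ) ^ (n + 2 + 1 - j)
        / (((n + 2 : ℕ) : ℚ) + 1) = (p : ℚ) ^ 3 * ((p * bernoulli j) * ((n + 2 + 1).choose j : ℕ) *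
      (p : ℚ) ^ (n - 1 - j) * (1 / ((n + 3 : ℕ) : ℚ))) := by
      intro j hj
      rw [Finset.mem_range] at hj
      rw [show n + 2 + 1 - j = (n - 1 - j) + 4 by omega]
      push_cast
      rw [show (n : ℚ) + 2 + 1 = n + 3 by ring]
      ring
    rw [Finset.sum_congr rfl this]
    push_cast
    rw [show (n : ℚ) + 2 + 1 = n + 3 by ring]
    field_simp
    ring

theorem base_two_voronoi_odd (p : ℕ) (hp : p.Prime) (hodd : Odd p)
    (i : ℕ) (hipos : 0 < i) (hiodd : Odd i)
    (h0 : ¬ i ≡ 0 [MOD p]) (h1 : ¬ i ≡ 1 [MOD p]) (h2 : ¬ i ≡ 2 [MOD p])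
    (h1' : ¬ i ≡ 1 [MOD p - 1]) (h3' : ¬ i ≡ 3 [MOD p - 1]) :
    (p : ℤ) ∣ (∑ k ∈ Finset.Icc 1 ((p - 1) / 2), ((p : ℤ) - 2 * (k : ℤ)) ^ (i - 1)) ∧
    ratCongr p 2 (bernoulli (i - 1) * (2 ^ i - 1))
      (2 * ((∑ k ∈ Finset.Icc 1 ((p - 1) / 2),
              ((p : ℤ) - 2 * (k : ℤ)) ^ (i - 1) : ℤ) : ℚ) / (p : ℚ)
        - ((i : ℚ) - 1) * 2 ^ (i - 2) *
            ∑ k ∈ Finset.Icc 1 ((p - 1) / 2), (k : ℚ) ^ (i - 2)) := by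
  have : Fact p.Prime := ⟨hp⟩
  have hp2 : p ≠ 2 := by rintro rfl; exact absurd hodd (by decide)
  have hi1 : i ≠ 1 := by rintro rfl; exact h1' rfl
  have hi3 : i ≠ 3 := by rintro rfl; exact h3' rfl
  obtain ⟨r, hr⟩ := hiodd
  obtain ⟨n, rfl⟩ : ∃ n, i = n + 3 := ⟨i - 3, by omega⟩
  have hn : Even n := ⟨r - 1, by omega⟩
  have hn2 : 2 ≤ n := by omega
  have hd0 : ¬ (p - 1) ∣ n := fun h => h3' (by
    simpa using (Nat.modEq_zero_iff_dvd.mpr h).add_right 3)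
  have hd2 : ¬ (p - 1) ∣ n + 2 := fun h => h1' (by
    exact (Nat.modEq_zero_iff_dvd.mpr h).add_right 1)
  have hd3 : ¬ p ∣ n + 3 := fun h => h0 (Nat.modEq_zero_iff_dvd.mpr h)
  obtain ⟨a, ha, hA⟩ := aux_faulhaber hp2 n hn hn2 hd0 hd3
  have hpV := aux_pow_sum (p := p) n hd0
  have hpA := aux_pow_sum (p := p) (n + 2) hd2
  obtain ⟨m, hm⟩ := hodd
  have hm' : (p - 1) / 2 = m := by omega
  rw [hm', show n + 3 - 1 = n + 2 by omega, show n + 3 - 2 = n + 1 by omega]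
  have hpair : ∀ l : ℕ, ∑ j ∈ Finset.Ico 1 p, (j : ℤ) ^ l
      = ∑ k ∈ Finset.Icc 1 m, (k : ℤ) ^ l + ∑ k ∈ Finset.Icc 1 m, ((p : ℤ) - 1 * k) ^ l := by
    intro l
    rw [hm, aux_pair]
    congr 1
    refine Finset.sum_congr rfl fun k hk => ?_
    rw [Finset.mem_Icc] at hk
    rw [Nat.cast_sub (by omega), one_mul]
  have hparity : ∑ j ∈ Finset.Ico 1 p, (j : ℤ) ^ (n + 2)
      = 2 ^ (n + 2) * ∑ k ∈ Finset.Icc 1 m, (k : ℤ) ^ (n + 2)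
        + ∑ k ∈ Finset.Icc 1 m, ((p : ℤ) - 2 * k) ^ (n + 2) := by
    rw [hm, aux_parity, Finset.mul_sum]
    congr 1
    · refine Finset.sum_congr rfl fun k hk => ?_
      push_cast
      rw [mul_pow]
    · refine Finset.sum_congr rfl fun k hk => ?_
      rw [Finset.mem_Icc] at hk
      rw [Nat.cast_sub (by omega)]
      push_cast
      rfl
  have hcop : IsCoprime (p : ℤ) 2 := by
    rw [show (2 : ℤ) = ((2 : ℕ) : ℤ) by rfl, Nat.isCoprime_iff_coprime]
    exact (Nat.coprime_primes hp Nat.prime_two).mpr hp2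
  obtain ⟨v, hv⟩ : (p : ℤ) ∣ ∑ k ∈ Finset.Icc 1 m, (k : ℤ) ^ n := by
    refine hcop.dvd_of_dvd_mul_left ?_
    rw [hpair] at hpV
    have : (p : ℤ) ∣ ∑ k ∈ Finset.Icc 1 m, ((p : ℤ) - 1 * k) ^ n
        - ∑ k ∈ Finset.Icc 1 m, (k : ℤ) ^ n := by
      rw [← Finset.sum_sub_distrib]
      refine Finset.dvd_sum fun k _ => ?_
      rw [← hn.neg_pow (k : ℤ)]
      exact dvd_trans ⟨1, by ring⟩ (sub_dvd_pow_sub_pow ((p : ℤ) - 1 * k) (-(k : ℤ)) n)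
    have := dvd_sub hpV this
    convert this using 1
    ring
  obtain ⟨b, hb⟩ := aux_sum_expand (Finset.Icc 1 m) n hn 2 p
  obtain ⟨c, hc⟩ := aux_sum_expand (Finset.Icc 1 m) n hn 1 p
  rw [hv] at hb hc
  have hpairA := hpair (n + 2)
  rw [hc] at hpairA
  have hAQ : ((∑ j ∈ Finset.Ico 1 p, (j : ℤ) ^ (n + 2) : ℤ) : ℚ)
      = p * bernoulli (n + 2) + p ^ 3 * a := by
    rw [← hA]; push_cast; rfl
  have hHQ : ∑ k ∈ Finset.Icc 1 m, (k : ℚ) ^ (n + 1)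
      = ((∑ k ∈ Finset.Icc 1 m, (k : ℤ) ^ (n + 1) : ℤ) : ℚ) := by push_cast; rfl
  rw [hHQ]
  generalize ∑ k ∈ Finset.Icc 1 m, (k : ℤ) ^ (n + 1) = H at *
  generalize ∑ k ∈ Finset.Icc 1 m, (k : ℤ) ^ (n + 2) = U at *
  generalize ∑ k ∈ Finset.Icc 1 m, ((p : ℤ) - 2 * k) ^ (n + 2) = S at *
  generalize ∑ j ∈ Finset.Ico 1 p, (j : ℤ) ^ (n + 2) = A at *
  generalize ((n + 2).choose 2 : ℕ) = C at *
  have h2S : 2 * S = A - (n + 2) * p * 2 ^ (n + 1) * H + p ^ 3 * (C * 2 ^ n * v + b) := by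
    linear_combination hb - hparity
  have h2A : (2 ^ (n + 2) - 1) * A = - (n + 2) * p * 2 ^ (n + 1) * H
      + p ^ 3 * (2 ^ (n + 2) * (C * v + c) - (C * 2 ^ n * v + b)) := by
    simp only [one_pow] at hpairA
    linear_combination 2 ^ (n + 2) * hpairA - hparity - hb
  constructor
  · refine hcop.dvd_of_dvd_mul_left ?_
    rw [h2S]
    obtain ⟨w, rfl⟩ := hpA
    exact ⟨w - (n + 2) * 2 ^ (n + 1) * H + p ^ 2 * (C * 2 ^ n * v + b), by ring⟩
  · have hp0 : (p : ℚ) ≠ 0 := by exact_mod_cast hp.ne_zero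
    have h2Sq := congrArg (Int.cast : ℤ → ℚ) h2S
    have h2Aq := congrArg (Int.cast : ℤ → ℚ) h2A
    set d : ℤ := C * 2 ^ n * v + b with hdd
    set e : ℤ := 2 ^ (n + 2) * (C * v + c) - d with hee
    clear_value e d
    push_cast at h2Sq h2Aq
    rw [hAQ] at h2Sq h2Aq
    refine ⟨2 * e - (2 ^ (n + 3) - 1) * a - d, ?_, ?_⟩
    · have e1 : 2 * (S : ℚ) / p = bernoulli (n + 2) + p ^ 2 * a - (n + 2) * 2 ^ (n + 1) * H
          + p ^ 2 * d := by
        rw [h2Sq]; field_simp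
      have e2 : (2 ^ (n + 2) - 1) * (bernoulli (n + 2) + p ^ 2 * a)
          = - (n + 2) * 2 ^ (n + 1) * (H : ℚ) + p ^ 2 * e := by
        apply mul_left_cancel₀ hp0
        linear_combination h2Aq
      rw [e1]
      push_cast
      linear_combination 2 * e2
    · rw [← auxR_iff]
      have two : (2 : ℚ) ∈ auxR p := by exact_mod_cast natCast_mem (auxR p) 2
      exact sub_mem (sub_mem (mul_mem two (intCast_mem _ _))
        (mul_mem (sub_mem (pow_mem two _) (one_mem _)) ha)) (intCast_mem _ _)
end

section
/- Let p be an odd prime and let i be a positive odd integer with i ≢ 0, 1, 2 (mod p), i ≢ 1 (mod p−1) and i ≢ 3 (mod p−1). Then the sum T = Σ_{k=1}^{(p−1)/2} k^{i−1} is divisible by p, and T/p ≡ B_{i−1}·(1 − 1/2^i) + (3(i−1)/4)·Σ_{k=1}^{(p−1)/2} k^{i−2} (mod p²). -/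
lemma icc_range (m : ℕ) (f : ℕ → ℤ) :
    ∑ k ∈ Finset.Icc 1 m, f k = ∑ k ∈ Finset.range m, f (k + 1) := by
  induction m with
  | zero => simp
  | succ m ih => rw [Finset.sum_Icc_succ_top (by omega), ih, Finset.sum_range_succ]

lemma split_one (m : ℕ) (f : ℤ → ℤ) :
    ∑ k ∈ Finset.range (2 * m + 1), f k
      = f 0 + ∑ k ∈ Finset.Icc 1 m, f k
        + ∑ k ∈ Finset.Icc 1 m, f ((2 * m + 1 : ℕ) - k) := by
  rw [icc_range m (fun k => f k), icc_range m (fun k => f ((2 * m + 1 : ℕ) - k)),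
    show 2 * m + 1 = (m + 1) + m by ring, Finset.sum_range_add, Finset.sum_range_succ',
    ← Finset.sum_range_reflect (fun x => f ((m + 1 + x : ℕ) : ℤ))]
  have : ∑ j ∈ Finset.range m, f ((m + 1 + (m - 1 - j) : ℕ) : ℤ)
      = ∑ k ∈ Finset.range m, f (((m + 1 + m : ℕ) : ℤ) - ((k + 1 : ℕ) : ℤ)) := by
    apply Finset.sum_congr rfl
    intro j hj
    have := Finset.mem_range.mp hj
    congr 1
    omega
  rw [this]
  simp only [Nat.cast_zero]
  ring

lemma split_two_aux (m : ℕ) (f : ℤ → ℤ) :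
    ∑ k ∈ Finset.range (2 * m + 1), f k
      = f 0 + ∑ k ∈ Finset.range m, f (2 * ((k + 1 : ℕ) : ℤ))
        + ∑ k ∈ Finset.range m, f ((2 * k + 1 : ℕ) : ℤ) := by
  induction m with
  | zero => simp
  | succ m ih =>
    rw [show 2 * (m + 1) + 1 = 2 * m + 1 + 1 + 1 by ring, Finset.sum_range_succ,
      Finset.sum_range_succ, ih, Finset.sum_range_succ _ m, Finset.sum_range_succ _ m]
    rw [show ((2 * m + 1 + 1 : ℕ) : ℤ) = 2 * ((m + 1 : ℕ) : ℤ) by push_cast; ring]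
    ring

lemma split_two (m : ℕ) (f : ℤ → ℤ) :
    ∑ k ∈ Finset.range (2 * m + 1), f k
      = f 0 + ∑ k ∈ Finset.Icc 1 m, f (2 * k)
        + ∑ k ∈ Finset.Icc 1 m, f ((2 * m + 1 : ℕ) - 2 * k) := by
  rw [icc_range m (fun k => f (2 * k)), icc_range m (fun k => f ((2 * m + 1 : ℕ) - 2 * k)),
    split_two_aux, ← Finset.sum_range_reflect (fun x => f ((2 * x + 1 : ℕ) : ℤ))]
  congr 1
  apply Finset.sum_congr rfl
  intro j hj
  have := Finset.mem_range.mp hj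
  congr 1
  omega

lemma expand_pow (y : ℤ) (N : ℕ) : ∃ A : ℤ, ∀ x : ℤ, ∃ e : ℤ,
    (x - y) ^ (N + 2) = x ^ (N + 2) - (N + 2) * y * x ^ (N + 1) + A * y ^ 2 * x ^ N
      + y ^ 3 * e := by
  induction N with
  | zero => exact ⟨1, fun x => ⟨0, by push_cast; ring⟩⟩
  | succ N ih =>
    obtain ⟨A, hA⟩ := ih
    refine ⟨A + (N + 2), fun x => ?_⟩
    obtain ⟨e, he⟩ := hA x
    refine ⟨e * (x - y) - A * x ^ N, ?_⟩
    rw [show N + 1 + 2 = (N + 2) + 1 by ring, pow_succ, he]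
    push_cast
    ring

/-- Expansion of the half sum of `(y - c k)^n` modulo `y^3`. -/
lemma expand_sum (y c : ℤ) (N m : ℕ) (hN : Even N)
    (hV : y ∣ ∑ k ∈ Finset.Icc 1 m, (k : ℤ) ^ N) : ∃ e : ℤ,
    ∑ k ∈ Finset.Icc 1 m, (y - c * k) ^ (N + 2)
      = c ^ (N + 2) * ∑ k ∈ Finset.Icc 1 m, (k : ℤ) ^ (N + 2)
        - (N + 2) * y * c ^ (N + 1) * ∑ k ∈ Finset.Icc 1 m, (k : ℤ) ^ (N + 1)
        + y ^ 3 * e := by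
  obtain ⟨A, hA⟩ := expand_pow y N
  choose e he using hA
  obtain ⟨v, hv⟩ := hV
  refine ⟨A * c ^ N * v + ∑ k ∈ Finset.Icc 1 m, e (c * k), ?_⟩
  have h2 : Even (N + 2) := hN.add (by decide)
  have : ∀ k ∈ Finset.Icc 1 m, (y - c * (k : ℤ)) ^ (N + 2)
      = c ^ (N + 2) * (k : ℤ) ^ (N + 2) - (N + 2) * y * c ^ (N + 1) * (k : ℤ) ^ (N + 1)
        + A * y ^ 2 * c ^ N * (k : ℤ) ^ N + y ^ 3 * e (c * k) := by
    intro k _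
    rw [← neg_sub, h2.neg_pow, he]
    simp only [mul_pow]
    ring
  rw [Finset.sum_congr rfl this, Finset.sum_add_distrib, Finset.sum_add_distrib,
    Finset.sum_sub_distrib, ← Finset.mul_sum, ← Finset.mul_sum, ← Finset.mul_sum,
    ← Finset.mul_sum, hv]
  ring

lemma full_sum_dvd {p : ℕ} [Fact p.Prime] {l : ℕ} (hl0 : l ≠ 0) (hl : ¬ (p - 1) ∣ l) :
    (p : ℤ) ∣ ∑ k ∈ Finset.range p, (k : ℤ) ^ l := by
  rw [← ZMod.intCast_zmod_eq_zero_iff_dvd]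
  push_cast
  have h0 : ∑ k ∈ Finset.range p, (k : ZMod p) ^ l = ∑ k ∈ Finset.Ico 1 p, (k : ZMod p) ^ l := by
    rw [Finset.sum_range_eq_add_Ico _ (Nat.Prime.pos Fact.out)]
    simp [hl0]
  have hbij : (∑ v ∈ Finset.Ico 1 p, (v : ZMod p) ^ l) = ∑ u : (ZMod p)ˣ, (u : ZMod p) ^ l :=
    Finset.sum_bij'
      (fun v hv ↦ Units.mk0 (v : ZMod p) (mt (ZMod.natCast_eq_zero_iff v p).mp (by
        grind [Nat.not_dvd_of_pos_of_lt])))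
      (fun u _ ↦ (u : ZMod p).val)
      (fun _ _ ↦ Finset.mem_univ _)
      (fun u _ ↦ by grind [u.ne_zero, ZMod.val_ne_zero, ZMod.val_lt])
      (fun v hv ↦ by simp [ZMod.val_cast_of_lt (Finset.mem_Ico.mp hv).2])
      (fun u _ ↦ Units.ext (ZMod.natCast_zmod_val _))
      (fun _ _ ↦ rfl)
  rw [h0, hbij, FiniteField.sum_pow_units, ZMod.card, if_neg hl]

lemma half_sum_dvd {p m : ℕ} [Fact p.Prime] (hm : p = 2 * m + 1) {l : ℕ} (hl0 : l ≠ 0)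
    (hle : Even l) (hl : ¬ (p - 1) ∣ l) :
    (p : ℤ) ∣ ∑ k ∈ Finset.Icc 1 m, (k : ℤ) ^ l := by
  have h := full_sum_dvd (p := p) hl0 hl
  have hs := split_one m (fun x => x ^ l)
  rw [← hm] at hs
  simp only [zero_pow hl0, zero_add] at hs
  rw [hs] at h
  have h2 : (p : ℤ) ∣ ∑ k ∈ Finset.Icc 1 m, ((p : ℤ) - k) ^ l
      - ∑ k ∈ Finset.Icc 1 m, (k : ℤ) ^ l := by
    rw [← Finset.sum_sub_distrib]
    apply Finset.dvd_sum
    intro k _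
    have : (p : ℤ) - k - (-k) ∣ ((p : ℤ) - k) ^ l - (-(k : ℤ)) ^ l := sub_dvd_pow_sub_pow _ _ _
    rwa [hle.neg_pow, sub_neg_eq_add, sub_add_cancel] at this
  have h3 := dvd_sub h h2
  rw [show ∀ a b : ℤ, a + b - (b - a) = 2 * a by intros; ring] at h3
  have hp : Prime (p : ℤ) := Nat.prime_iff_prime_int.mp Fact.out
  rcases hp.dvd_or_dvd h3 with h4 | h4
  · exfalso
    have : p ∣ 2 := by exact_mod_cast h4
    have h5 := (Nat.prime_dvd_prime_iff_eq Fact.out Nat.prime_two).mp this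
    omega
  · exact h4

/-- The ring of `p`-integral rationals. -/
def RR (p : ℕ) [Fact p.Prime] : Subring ℚ := (Rat.padicValuation p).integer

lemma mem_RR {p : ℕ} [Fact p.Prime] {x : ℚ} : x ∈ RR p ↔ ¬ p ∣ x.den := by
  rw [← Rat.padicValuation_le_one_iff]
  rfl

lemma inv_mem_RR {p : ℕ} [Fact p.Prime] {n : ℕ} (h : ¬ p ∣ n) : (n : ℚ)⁻¹ ∈ RR p := by
  rw [mem_RR, Rat.inv_natCast_den]
  split_ifs
  · simpa using (Fact.out : p.Prime).one_lt.ne'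
  · exact h

lemma pow_div_mem_s13 {p M N : ℕ} [Fact p.Prime] (hM : M ≠ 0)
    (hv : M.factorization p ≤ N) : (p : ℚ) ^ N / M ∈ RR p := by
  have hp_ne : (p : ℚ) ≠ 0 := Nat.cast_ne_zero.mpr (Nat.Prime.ne_zero Fact.out)
  have hd : ¬ p ∣ M / p ^ M.factorization p := Nat.not_dvd_ordCompl Fact.out hM
  have h1 : p ^ M.factorization p * (M / p ^ M.factorization p) = M :=
    Nat.ordProj_mul_ordCompl_eq_self M p
  have h2 : (p : ℚ) ^ N / M = (p : ℚ) ^ (N - M.factorization p)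
      * ((M / p ^ M.factorization p : ℕ) : ℚ)⁻¹ := by
    generalize M / p ^ M.factorization p = q at *
    generalize M.factorization p = e at *
    subst h1
    obtain ⟨d, rfl⟩ := Nat.exists_eq_add_of_le hv
    have : (q : ℚ) ≠ 0 := by
      rintro h
      simp_all
    rw [Nat.add_sub_cancel_left]
    push_cast
    field_simp
    try ring
  rw [h2]
  exact mul_mem (pow_mem (natCast_mem _ _) _) (inv_mem_RR hd)

lemma bern_mem {p : ℕ} [Fact p.Prime] {k : ℕ} (h : ¬ (p - 1) ∣ 2 * k) :
    bernoulli (2 * k) ∈ RR p := by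
  obtain ⟨z, hz⟩ := Bernoulli.vonStaudt_clausen k
  rw [eq_sub_of_add_eq hz.symm]
  refine sub_mem (intCast_mem _ _) (sum_mem fun q hq => ?_)
  simp only [Finset.mem_filter] at hq
  rw [one_div]
  apply inv_mem_RR
  intro hd
  rw [Nat.prime_dvd_prime_iff_eq Fact.out hq.2.1] at hd
  subst hd
  exact h hq.2.2

lemma p_bern_mem {p : ℕ} [Fact p.Prime] (hp2 : p ≠ 2) (j : ℕ) :
    (p : ℚ) * bernoulli j ∈ RR p := by
  rcases Nat.even_or_odd' j with ⟨k, rfl | rfl⟩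
  · obtain ⟨z, hz⟩ := Bernoulli.vonStaudt_clausen k
    rw [eq_sub_of_add_eq hz.symm, mul_sub, Finset.mul_sum]
    refine sub_mem (mul_mem (natCast_mem _ _) (intCast_mem _ _)) (sum_mem fun q hq => ?_)
    simp only [Finset.mem_filter] at hq
    by_cases hqp : p = q
    · subst hqp
      have : (p : ℚ) ≠ 0 := Nat.cast_ne_zero.mpr (Nat.Prime.ne_zero Fact.out)
      rw [mul_one_div_cancel this]
      exact one_mem _
    · rw [one_div]
      refine mul_mem (natCast_mem _ _) (inv_mem_RR fun hd => hqp ?_)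
      rwa [Nat.prime_dvd_prime_iff_eq Fact.out hq.2.1] at hd
  · rcases Nat.eq_zero_or_pos k with rfl | hk
    · have : ((2 : ℕ) : ℚ)⁻¹ ∈ RR p := inv_mem_RR fun hd =>
        hp2 ((Nat.prime_dvd_prime_iff_eq Fact.out Nat.prime_two).mp hd)
      have h := mul_mem (natCast_mem (RR p) p) (neg_mem this)
      convert h using 2
      rw [mul_zero, zero_add, bernoulli_one]
      norm_num
    · rw [bernoulli_eq_zero_of_odd ⟨k, rfl⟩ (by omega), mul_zero]
      exact zero_mem _

lemma fact_le {p r : ℕ} [Fact p.Prime] (hp : 7 ≤ p) (hr : 4 ≤ r) :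
    r.factorization p ≤ r - 4 := by
  by_cases h : r < p
  · rw [Nat.factorization_eq_zero_of_lt h]; omega
  · apply Nat.factorization_le_of_le_pow
    have : ∀ d, d + 7 ≤ 2 ^ (d + 3) := by
      intro d
      induction d with
      | zero => norm_num
      | succ d ih => rw [show d + 1 + 3 = (d + 3) + 1 by ring, pow_succ]; omega
    obtain ⟨d, rfl⟩ : ∃ d, r = d + 7 := ⟨r - 7, by omega⟩
    calc d + 7 ≤ 2 ^ (d + 3) := this d
      _ ≤ p ^ (d + 7 - 4) := by
        rw [show d + 7 - 4 = d + 3 by omega]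
        exact Nat.pow_le_pow_left (by omega) _

lemma faulhaber_mod {p : ℕ} [Fact p.Prime] (hp : 7 ≤ p) {k : ℕ} (hk : 1 ≤ k)
    (h : ¬ (p - 1) ∣ 2 * k) :
    ∃ s ∈ RR p, ∑ a ∈ Finset.range p, (a : ℚ) ^ (2 * k + 2)
      = p * bernoulli (2 * k + 2) + p ^ 3 * s := by
  have hp0 : (p : ℚ) ≠ 0 := Nat.cast_ne_zero.mpr (Nat.Prime.ne_zero Fact.out)
  have key : ∀ j ∈ Finset.range (2 * k + 2), ∃ s ∈ RR p,
      bernoulli j * ((2 * k + 2 + 1).choose j) * (p : ℚ) ^ (2 * k + 2 + 1 - j)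
        / ((2 * k + 2 : ℕ) + 1) = p ^ 3 * s := by
    intro j hj
    have hj' := Finset.mem_range.mp hj
    obtain ⟨r, hr⟩ : ∃ r, 2 * k + 3 = j + r := ⟨2 * k + 3 - j, by omega⟩
    have hch : ((2 * k + 2 + 1).choose j : ℚ) / ((2 * k + 2 : ℕ) + 1)
        = (2 * k + 2).choose j * (r : ℚ)⁻¹ := by
      have := Nat.choose_mul_succ_eq (2 * k + 2) j
      rw [show 2 * k + 2 + 1 - j = r by omega] at this
      have hr0 : (r : ℚ) ≠ 0 := by
        norm_cast; omega
      have hk0 : (((2 * k + 2 : ℕ) : ℚ) + 1) ≠ 0 := by norm_cast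
      have h3 : ((2 * k + 2).choose j : ℚ) * ((2 * k + 2 : ℕ) + 1)
        = (2 * k + 2 + 1).choose j * r := by exact_mod_cast this
      field_simp
      linarith
    have hrw : bernoulli j * ((2 * k + 2 + 1).choose j) * (p : ℚ) ^ (2 * k + 2 + 1 - j)
        / ((2 * k + 2 : ℕ) + 1)
        = bernoulli j * (p : ℚ) ^ r * (((2 * k + 2).choose j) * (r : ℚ)⁻¹) := by
      rw [← hch, show 2 * k + 2 + 1 - j = r by omega]; ring
    rw [hrw]
    by_cases h2 : r = 2
    · refine ⟨0, zero_mem _, ?_⟩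
      rw [bernoulli_eq_zero_of_odd ⟨k, by omega⟩ (by omega)]
      simp
    by_cases h3 : r = 3
    · subst h3
      have hjk : j = 2 * k := by omega
      subst hjk
      refine ⟨bernoulli (2 * k) * (((2 * k + 2).choose (2 * k)) * ((3 : ℕ) : ℚ)⁻¹),
        mul_mem (bern_mem h) (mul_mem (natCast_mem _ _) (inv_mem_RR ?_)), by ring⟩
      intro hd
      have := Nat.le_of_dvd (by norm_num) hd
      omega
    · refine ⟨(p * bernoulli j) * (((2 * k + 2).choose j) * ((p : ℚ) ^ (r - 4) / r)),
        mul_mem (p_bern_mem (by omega) j) (mul_mem (natCast_mem _ _)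
          (pow_div_mem_s13 (by omega) (fact_le hp (by omega)))), ?_⟩
      obtain ⟨d, rfl⟩ : ∃ d, r = d + 4 := ⟨r - 4, by omega⟩
      rw [Nat.add_sub_cancel]
      ring
  choose! s hs hs' using key
  refine ⟨∑ j ∈ Finset.range (2 * k + 2), s j, sum_mem hs, ?_⟩
  rw [sum_range_pow, Finset.sum_range_succ, Finset.sum_congr rfl hs', ← Finset.mul_sum, add_comm]
  congr 1
  rw [Nat.choose_succ_self_right, show 2 * k + 2 + 1 - (2 * k + 2) = 1 by omega]
  have hk0 : (((2 * k + 2 : ℕ) : ℚ) + 1) ≠ 0 := by norm_cast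
  push_cast at hk0 ⊢
  field_simp

/-- Congruence (28): divisibility of `T = Σ k^{i-1}` by `p` and
`T/p ≡ B_{i-1}(1 - 2^{-i}) + (3(i-1)/4)·Σ k^{i-2} (mod p²)`. -/
theorem half_sum_congruence (p : ℕ) (hp : p.Prime) (hodd : Odd p)
    (i : ℕ) (hipos : 0 < i) (hiodd : Odd i)
    (h0 : ¬ i ≡ 0 [MOD p]) (h1 : ¬ i ≡ 1 [MOD p]) (h2 : ¬ i ≡ 2 [MOD p])
    (h1' : ¬ i ≡ 1 [MOD p - 1]) (h3' : ¬ i ≡ 3 [MOD p - 1]) :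
    (p : ℤ) ∣ (∑ k ∈ Finset.Icc 1 ((p - 1) / 2), (k : ℤ) ^ (i - 1)) ∧
    ratCongr p 2
      (((∑ k ∈ Finset.Icc 1 ((p - 1) / 2), (k : ℤ) ^ (i - 1) : ℤ) : ℚ) / (p : ℚ))
      (bernoulli (i - 1) * (1 - 1 / 2 ^ i)
        + (3 * ((i : ℚ) - 1) / 4) *
            ∑ k ∈ Finset.Icc 1 ((p - 1) / 2), (k : ℚ) ^ (i - 2)) := by
  have : Fact p.Prime := ⟨hp⟩
  obtain ⟨m, hm⟩ := hodd
  obtain ⟨j, hj⟩ := hiodd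
  have hi1 : i ≠ 1 := by rintro rfl; exact h1' rfl
  have hi3 : i ≠ 3 := by rintro rfl; exact h3' rfl
  obtain ⟨k, rfl⟩ : ∃ k, j = k + 1 := ⟨j - 1, by omega⟩
  have hk : 1 ≤ k := by omega
  subst hj
  have hd3 : ¬ (p - 1) ∣ 2 * k := by
    intro hd
    apply h3'
    have := (Nat.modEq_zero_iff_dvd.mpr hd).add_right 3
    simpa [show 2 * (k + 1) + 1 = 2 * k + 3 by ring] using this
  have hd1 : ¬ (p - 1) ∣ 2 * k + 2 := by
    intro hd
    apply h1'
    have := (Nat.modEq_zero_iff_dvd.mpr hd).add_right 1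
    simpa [show 2 * (k + 1) + 1 = 2 * k + 2 + 1 by ring] using this
  have hp7 : 7 ≤ p := by
    by_contra hlt
    have h2le := hp.two_le
    have : p = 3 ∨ p = 5 := by omega
    rcases this with rfl | rfl <;> simp at hd1 hd3 <;> omega
  have hpm : (p - 1) / 2 = m := by omega
  rw [hpm, show 2 * (k + 1) + 1 - 1 = 2 * k + 2 by omega,
    show 2 * (k + 1) + 1 - 2 = 2 * k + 1 by omega]
  have hT := half_sum_dvd hm (l := 2 * k + 2) (by omega) ⟨k + 1, by ring⟩ hd1
  have hV := half_sum_dvd hm (l := 2 * k) (by omega) ⟨k, by ring⟩ hd3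
  refine ⟨hT, ?_⟩
  obtain ⟨b, hb⟩ := expand_sum p 1 (2 * k) m ⟨k, by ring⟩ hV
  obtain ⟨a, ha⟩ := expand_sum p 2 (2 * k) m ⟨k, by ring⟩ hV
  obtain ⟨s, hs, hF⟩ := faulhaber_mod hp7 hk hd3
  have e1 := split_one m (fun x => x ^ (2 * k + 2))
  have e2 := split_two m (fun x => x ^ (2 * k + 2))
  rw [← hm] at e1 e2
  simp only [one_mul, one_pow, mul_one] at hb
  simp only [zero_pow (show 2 * k + 2 ≠ 0 by omega), zero_add, mul_pow, ← Finset.mul_sum] at e1 e2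
  rw [hb] at e1
  rw [ha] at e2
  have hU : ∑ x ∈ Finset.Icc 1 m, (x : ℚ) ^ (2 * k + 1)
      = ((∑ x ∈ Finset.Icc 1 m, (x : ℤ) ^ (2 * k + 1) : ℤ) : ℚ) := by push_cast; rfl
  have hS : ∑ x ∈ Finset.range p, (x : ℚ) ^ (2 * k + 2)
      = ((∑ x ∈ Finset.range p, (x : ℤ) ^ (2 * k + 2) : ℤ) : ℚ) := by push_cast; rfl
  rw [hU]
  rw [hS] at hF
  generalize (∑ x ∈ Finset.range p, (x : ℤ) ^ (2 * k + 2)) = S at *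
  generalize (∑ x ∈ Finset.Icc 1 m, (x : ℤ) ^ (2 * k + 2)) = T at *
  generalize (∑ x ∈ Finset.Icc 1 m, (x : ℤ) ^ (2 * k + 1)) = U at *
  have f1 : (S : ℚ) = T + (T - (2 * k + 2) * p * U + p ^ 3 * b) := by exact_mod_cast e1
  have f2 : (S : ℚ) = 2 ^ (2 * k + 2) * T + (2 ^ (2 * k + 2) * T
      - (2 * k + 2) * p * 2 ^ (2 * k + 1) * U + p ^ 3 * a) := by exact_mod_cast e2
  have hp0 : (p : ℚ) ≠ 0 := Nat.cast_ne_zero.mpr hp.ne_zero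
  have h2inv : (((2 : ℕ) : ℚ)⁻¹) ∈ RR p := inv_mem_RR fun hd => by
    have := Nat.le_of_dvd (by norm_num) hd
    omega
  set w : ℚ := ((2 : ℕ) : ℚ)⁻¹ ^ (2 * k + 3) with hw
  have hwm : w ∈ RR p := pow_mem h2inv _
  refine ⟨a * w + s * (1 - w) - b, ?_, mem_RR.mp ?_⟩
  · have hw1 : (1 : ℚ) / 2 ^ (2 * (k + 1) + 1) = w := by
      rw [hw, show 2 * (k + 1) + 1 = 2 * k + 3 by ring]; simp
    rw [hw1]
    have hw2 : w * 2 ^ (2 * k + 3) = 1 := by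
      rw [hw, ← mul_pow]; norm_num
    have hB : bernoulli (2 * k + 2) = (S - p ^ 3 * s) / p := by
      field_simp; linarith
    have hSw : S * w = T - (2 * k + 2) * p * U / 4 + p ^ 3 * a * w := by
      have : S * w = T * (w * 2 ^ (2 * k + 3))
          - (2 * k + 2) * p * U / 4 * (w * 2 ^ (2 * k + 3)) + p ^ 3 * a * w := by
        rw [f2]; ring
      rw [this, hw2]; ring
    clear_value w
    rw [hB]
    push_cast
    field_simp
    linear_combination 4 * hSw - 4 * f1
  · exact sub_mem (add_mem (mul_mem (intCast_mem _ _) hwm)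
      (mul_mem hs (sub_mem (one_mem _) hwm))) (intCast_mem _ _)
end
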